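/- Suppose Ω ⊂ ℂ^d is a bounded convex domain with C² boundary, f : Ω → Ω is a holomorphic map, and ξ₀ ∈ ∂Ω is such that ‖f(z) − z‖ / ‖z − ξ₀‖⁴ → 0 as z → ξ₀ in Ω. If η ∈ ∂Ω is a boundary point whose closed complex face is a single point, i.e. ∂Ω ∩ H_η∂Ω = {η} (as holds at every strongly convex boundary point), and q_n ∈ Ω is any sequence with q_n → η, then f(q_n) → η. -/

import Mathlib

open Set Filter Metric Topology MeasureTheory Asymptotics

noncomputable section

/-- `H_x ∂Ω` relative to the defining function `r`: the unique complex affine hyperplane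
through `x` contained in the real tangent hyperplane to `∂Ω` at `x`, namely the set of `z`
with `z - x` in the maximal complex subspace of `ker (dr)_x`. -/
def cxTangent {E : Type*} [NormedAddCommGroup E] [NormedSpace ℂ E]
    (r : E → ℝ) (x : E) : Set E :=
  {z | fderiv ℝ r x (z - x) = 0 ∧ fderiv ℝ r x (Complex.I • (z - x)) = 0}

/-- A holomorphic function on the unit disc with positive real part satisfies
`‖g ζ‖ ≤ 2 ‖g 0‖ / (1 - ‖ζ‖)`. -/
theorem norm_mul_le_of_re_pos {g : ℂ → ℂ} (hg : DifferentiableOn ℂ g (ball 0 1))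
    (hpos : ∀ ζ ∈ ball (0 : ℂ) 1, 0 < (g ζ).re) {ζ : ℂ} (hζ : ζ ∈ ball (0 : ℂ) 1) :
    ‖g ζ‖ * (1 - ‖ζ‖) ≤ 2 * ‖g 0‖ := by
  have h0 : (0 : ℂ) ∈ ball (0 : ℂ) 1 := by simp
  set a := g 0 with ha
  have ha0 : 0 < a.re := hpos 0 h0
  have hden : ∀ w ∈ ball (0 : ℂ) 1, g w + (starRingEnd ℂ) a ≠ 0 := by
    intro w hw h
    have := congrArg Complex.re h
    simp at this
    have := hpos w hw
    linarith
  set m : ℂ → ℂ := fun w => (g w - a) / (g w + (starRingEnd ℂ) a) with hm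
  have hmd : DifferentiableOn ℂ m (ball 0 1) :=
    (hg.sub_const a).div (hg.add_const _) hden
  have hmaps : MapsTo m (ball 0 1) (closedBall 0 1) := by
    intro w hw
    rw [mem_closedBall_zero_iff, hm]
    simp only [norm_div]
    rw [div_le_one (norm_pos_iff.2 (hden w hw))]
    have := hpos w hw
    rw [← sq_le_sq₀ (norm_nonneg _) (norm_nonneg _), ← Complex.normSq_eq_norm_sq,
      ← Complex.normSq_eq_norm_sq]
    simp only [Complex.normSq_apply, Complex.sub_re, Complex.sub_im, Complex.add_re,
      Complex.add_im, Complex.conj_re, Complex.conj_im]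
    nlinarith
  have hm0 : m 0 = 0 := by simp [hm, ← ha]
  have hle : ‖m ζ‖ ≤ ‖ζ‖ := Complex.norm_le_norm_of_mapsTo_ball hmd hmaps hm0
    (by simpa using hζ)
  have hζ1 : ‖ζ‖ < 1 := by simpa using hζ
  have key : g ζ * (1 - m ζ) = a + (starRingEnd ℂ) a * m ζ := by
    have := hden ζ hζ
    simp only [hm]
    field_simp
    ring
  have h1 : ‖g ζ‖ * ‖1 - m ζ‖ ≤ ‖a‖ + ‖a‖ * ‖m ζ‖ := by
    rw [← norm_mul, key]
    refine (norm_add_le _ _).trans ?_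
    simp
  have h2 : 1 - ‖ζ‖ ≤ ‖1 - m ζ‖ := by
    have := norm_sub_norm_le (1 : ℂ) (m ζ)
    simp at this
    linarith
  have h3 := mul_le_mul_of_nonneg_left h2 (norm_nonneg (g ζ))
  nlinarith [norm_nonneg a]

section Reach

variable {E : Type*} [NormedAddCommGroup E] [NormedSpace ℂ E]

theorem opNorm_mul_le_of_re_le {L : E →L[ℂ] ℂ} {ρ t : ℝ} (hρ : 0 < ρ)
    (h : ∀ u : E, ‖u‖ < ρ → (L u).re ≤ t) : ρ * ‖L‖ ≤ t := by
  have ht : 0 ≤ t := by simpa using h 0 (by simpa using hρ)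
  have key : ∀ u : E, ‖u‖ < ρ → ‖L u‖ ≤ t := by
    intro u hu
    rcases eq_or_ne (L u) 0 with h0 | h0
    · simpa [h0] using ht
    · have hn : ‖L u‖ ≠ 0 := norm_ne_zero_iff.2 h0
      set c : ℂ := (starRingEnd ℂ) (L u) / ‖L u‖
      have hc : ‖c‖ = 1 := by simp [c, hn]
      have hcu : L (c • u) = ‖L u‖ := by
        rw [map_smul, smul_eq_mul, div_mul_eq_mul_div, mul_comm, Complex.mul_conj,
          Complex.normSq_eq_norm_sq]
        have : (‖L u‖ : ℂ) ≠ 0 := by exact_mod_cast hn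
        push_cast
        field_simp
      have := h (c • u) (by rw [norm_smul, hc, one_mul]; exact hu)
      rw [hcu] at this
      simpa using this
  have small : ∀ ρ', 0 < ρ' → ρ' < ρ → ρ' * ‖L‖ ≤ t := by
    intro ρ' h0 hlt
    have : ‖L‖ ≤ t / ρ' := by
      refine L.opNorm_le_bound (by positivity) fun x => ?_
      rcases eq_or_ne x 0 with rfl | hx
      · simp
      · have hx' : 0 < ‖x‖ := norm_pos_iff.2 hx
        have hc : ‖((ρ' / ‖x‖ : ℝ) : ℂ)‖ = ρ' / ‖x‖ := by
          rw [Complex.norm_real, Real.norm_of_nonneg (by positivity)]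
        have := key (((ρ' / ‖x‖ : ℝ) : ℂ) • x) (by
          rw [norm_smul, hc, div_mul_cancel₀ _ hx'.ne']; exact hlt)
        rw [map_smul, norm_smul, hc, div_mul_eq_mul_div, div_le_iff₀ hx'] at this
        rw [div_mul_eq_mul_div, le_div_iff₀ h0]
        linarith
    rw [le_div_iff₀ h0] at this
    linarith
  by_contra! hlt
  have hL : 0 < ‖L‖ := pos_of_mul_pos_right (ht.trans_lt hlt) hρ.le
  have h1 : t / ‖L‖ < ρ := (div_lt_iff₀ hL).2 hlt
  have h2 : 0 ≤ t / ‖L‖ := by positivity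
  have h3 := small ((t / ‖L‖ + ρ) / 2) (by linarith) (by linarith)
  have h4 : t / ‖L‖ * ‖L‖ = t := div_mul_cancel₀ _ hL.ne'
  nlinarith

theorem opNorm_mul_le_of_ball_subset {L : E →L[ℂ] ℂ} {ρ t : ℝ} {p : E} (hρ : 0 < ρ)
    (h : ∀ x ∈ ball p ρ, (L x).re ≤ t) : ρ * ‖L‖ ≤ t - (L p).re := by
  refine opNorm_mul_le_of_re_le hρ fun u hu => ?_
  have := h (p + u) (by simpa using hu)
  simp at this
  linarith

/-- A holomorphic disc in a convex domain stays at a controlled distance from the complement. -/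
theorem ball_subset_of_disc {Ω : Set E} (hΩo : IsOpen Ω) (hΩc : Convex ℝ Ω) {φ : ℂ → E}
    (hφ : DifferentiableOn ℂ φ (ball 0 1)) (hm : MapsTo φ (ball 0 1) Ω) {ρ : ℝ} (hρ : 0 < ρ)
    (hball : ball (φ 0) ρ ⊆ Ω) {ζ : ℂ} (hζ : ζ ∈ ball (0 : ℂ) 1) :
    ball (φ ζ) (ρ * (1 - ‖ζ‖) / 2) ⊆ Ω := by
  intro y hy
  by_contra hyΩ
  obtain ⟨L, hL⟩ := RCLike.geometric_hahn_banach_open_point (𝕜 := ℂ) hΩc hΩo hyΩ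
  simp only [RCLike.re_eq_complex_re] at hL
  set g : ℂ → ℂ := fun w => L y - L (φ w) with hg
  have hgd : DifferentiableOn ℂ g (ball 0 1) :=
    (L.differentiable.comp_differentiableOn hφ).const_sub _
  have hgpos : ∀ w ∈ ball (0 : ℂ) 1, 0 < (g w).re := by
    intro w hw
    have := hL _ (hm hw)
    simp [hg]; linarith
  have hζ1 : ‖ζ‖ < 1 := by simpa using hζ
  have hginv : DifferentiableOn ℂ (fun w => (g w)⁻¹) (ball 0 1) := hgd.inv fun w hw h => by
    have := hgpos w hw
    simp [h] at this
  have hginvpos : ∀ w ∈ ball (0 : ℂ) 1, 0 < ((g w)⁻¹).re := by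
    intro w hw
    have h := hgpos w hw
    rw [Complex.inv_re]
    refine div_pos h (Complex.normSq_pos.2 ?_)
    rintro h'
    simp [h'] at h
  have h1 := norm_mul_le_of_re_pos hginv hginvpos hζ
  have h0 : 0 < (g 0).re := hgpos 0 (by simp)
  have hg0 : 0 < ‖g 0‖ := h0.trans_le (Complex.re_le_norm _)
  have hgζ : 0 < ‖g ζ‖ := (hgpos ζ hζ).trans_le (Complex.re_le_norm _)
  have h2 : ρ * ‖L‖ ≤ ‖g 0‖ := by
    refine (opNorm_mul_le_of_ball_subset hρ (t := (L y).re) (p := φ 0)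
      fun x hx => (hL x (hball hx)).le).trans ?_
    refine le_trans ?_ (Complex.re_le_norm _)
    simp [hg]
  have h3 : ‖g ζ‖ ≤ ‖L‖ * ‖y - φ ζ‖ := by
    have := L.le_opNorm (y - φ ζ)
    simpa [hg] using this
  simp only [norm_inv] at h1
  have h4 : ‖g 0‖ * (1 - ‖ζ‖) ≤ 2 * ‖g ζ‖ := by
    have := mul_le_mul_of_nonneg_left h1 (mul_pos hg0 hgζ).le
    field_simp at this
    linarith
  rw [mem_ball, dist_eq_norm] at hy
  have hLpos : 0 < ‖L‖ := by
    rcases (norm_nonneg L).eq_or_lt with h | h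
    · rw [← h] at h3; simp at h3; rw [h3] at hgζ; simp at hgζ
    · exact h
  nlinarith [mul_le_mul_of_nonneg_right h2 (sub_nonneg.2 hζ1.le), mul_lt_mul_of_pos_left hy hLpos]

/-- Maximum principle for maps into an open convex set. -/
theorem mapsTo_of_mapsTo_sphere {Ω : Set E} (hΩo : IsOpen Ω) (hΩc : Convex ℝ Ω) {χ : ℂ → E}
    {R : ℝ} (hR : 0 < R) (hχ : DiffContOnCl ℂ χ (ball 0 R)) (hs : MapsTo χ (sphere 0 R) Ω) :
    MapsTo χ (ball 0 R) Ω := by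
  intro ζ hζ
  by_contra hy
  obtain ⟨L, hL⟩ := RCLike.geometric_hahn_banach_open_point (𝕜 := ℂ) hΩc hΩo hy
  simp only [RCLike.re_eq_complex_re] at hL
  have hd : DiffContOnCl ℂ (fun w => Complex.exp (L (χ w))) (ball 0 R) :=
    Complex.differentiable_exp.comp_diffContOnCl (L.differentiable.comp_diffContOnCl hχ)
  obtain ⟨w, hw, hmax⟩ := Complex.exists_mem_frontier_isMaxOn_norm isBounded_ball
    ⟨0, mem_ball_self hR⟩ hd
  rw [frontier_ball _ hR.ne'] at hw
  have := hmax (subset_closure hζ)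
  simp [Complex.norm_exp] at this
  have := hL _ (hs hw)
  linarith

/-- `p` is the value at `s` of a holomorphic disc in `Ω` centred at `z`. -/
def Reach (Ω : Set E) (z p : E) (s : ℝ) : Prop :=
  ∃ φ : ℂ → E, DifferentiableOn ℂ φ (ball 0 1) ∧ MapsTo φ (ball 0 1) Ω ∧ φ 0 = z ∧ φ s = p

theorem Reach.convex {Ω : Set E} (hΩc : Convex ℝ Ω) (z : E) (s : ℝ) :
    Convex ℝ {p | Reach Ω z p s} := by
  rintro p ⟨φ, hφ, hφm, hφ0, hφs⟩ q ⟨ψ, hψ, hψm, hψ0, hψs⟩ a b ha hb hab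
  refine ⟨fun w => a • φ w + b • ψ w, (hφ.const_smul a).add (hψ.const_smul b),
    fun w hw => hΩc (hφm hw) (hψm hw) ha hb hab, ?_, ?_⟩
  · simp only [hφ0, hψ0, ← add_smul, hab, one_smul]
  · simp only [hφs, hψs]

theorem Reach.mono {Ω : Set E} {z p : E} {s t : ℝ} (h : Reach Ω z p s) (hs : 0 ≤ s)
    (hst : s ≤ t) (ht : 0 < t) : Reach Ω z p t := by
  obtain ⟨φ, hφ, hφm, hφ0, hφs⟩ := h
  have hmaps : MapsTo (fun w : ℂ => ((s / t : ℝ) : ℂ) * w) (ball 0 1) (ball 0 1) := by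
    intro w hw
    rw [mem_ball_zero_iff] at hw ⊢
    rw [norm_mul, Complex.norm_real, Real.norm_of_nonneg (by positivity)]
    have : s / t ≤ 1 := (div_le_one ht).2 hst
    nlinarith [norm_nonneg w]
  refine ⟨fun w => φ (((s / t : ℝ) : ℂ) * w), hφ.comp (by fun_prop) hmaps, hφm.comp hmaps,
    by simpa using hφ0, ?_⟩
  simp only [← hφs, ← Complex.ofReal_mul, div_mul_cancel₀ _ ht.ne']

theorem norm_add_lt_norm_one_add {a : ℝ} (ha : |a| < 1) {ζ : ℂ} (hζ : ‖ζ‖ < 1) :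
    ‖ζ + a‖ < ‖1 + a * ζ‖ := by
  rw [← sq_lt_sq₀ (norm_nonneg _) (norm_nonneg _), ← Complex.normSq_eq_norm_sq,
    ← Complex.normSq_eq_norm_sq]
  have h1 : ζ.re ^ 2 + ζ.im ^ 2 < 1 := by
    have := Complex.normSq_eq_norm_sq ζ
    rw [Complex.normSq_apply] at this
    nlinarith [norm_nonneg ζ]
  have h2 : a ^ 2 < 1 := by rw [sq_lt_one_iff_abs_lt_one]; exact ha
  simp [Complex.normSq_apply]
  nlinarith

/-- Invariance of the reach under automorphisms of the disc preserving the real diameter. -/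
theorem Reach.of_two_points {Ω : Set E} {φ : ℂ → E} (hφ : DifferentiableOn ℂ φ (ball 0 1))
    (hm : MapsTo φ (ball 0 1) Ω) {a b : ℝ} (ha : |a| < 1) (hb : |b| < 1) :
    Reach Ω (φ a) (φ b) ((b - a) / (1 - a * b)) := by
  have hden : ∀ ζ ∈ ball (0 : ℂ) 1, 1 + a * ζ ≠ 0 := by
    intro ζ hζ h
    have := norm_add_lt_norm_one_add ha (ζ := ζ) (by simpa using hζ)
    rw [h, norm_zero] at this
    exact absurd this (norm_nonneg _).not_gt
  have hmaps : MapsTo (fun ζ : ℂ => (ζ + a) / (1 + a * ζ)) (ball 0 1) (ball 0 1) := by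
    intro ζ hζ
    rw [mem_ball_zero_iff, norm_div, div_lt_one (norm_pos_iff.2 (hden ζ hζ))]
    exact norm_add_lt_norm_one_add ha (by simpa using hζ)
  have hd : DifferentiableOn ℂ (fun ζ : ℂ => (ζ + a) / (1 + a * ζ)) (ball 0 1) :=
    DifferentiableOn.div (by fun_prop) (by fun_prop) hden
  refine ⟨_, hφ.comp hd hmaps, hm.comp hmaps, by simp, ?_⟩
  have h1 : (1 - a * b : ℝ) ≠ 0 := by
    have := abs_lt.1 ha; have := abs_lt.1 hb
    nlinarith
  have h2 : (1 - a ^ 2 : ℝ) ≠ 0 := by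
    have : a ^ 2 < 1 := by rw [sq_lt_one_iff_abs_lt_one]; exact ha
    linarith
  have hreal : ((b - a) / (1 - a * b) + a) / (1 + a * ((b - a) / (1 - a * b))) = b := by
    have h4 : 1 + a * ((b - a) / (1 - a * b)) = (1 - a ^ 2) / (1 - a * b) := by
      rw [eq_div_iff h1, add_mul, mul_assoc, div_mul_cancel₀ _ h1]; ring
    have h5 : (b - a) / (1 - a * b) + a = b * (1 - a ^ 2) / (1 - a * b) := by
      rw [eq_div_iff h1, add_mul, div_mul_cancel₀ _ h1]; ring
    rw [h4, h5, div_div_div_cancel_right₀ h1, mul_div_assoc, div_self h2, mul_one]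
  simp only [Function.comp]
  congr 1
  exact_mod_cast hreal

theorem Reach.symm {Ω : Set E} {z p : E} {s : ℝ} (h : Reach Ω z p s) (hs : |s| < 1) :
    Reach Ω p z s := by
  obtain ⟨φ, hφ, hφm, hφ0, hφs⟩ := h
  have hneg : MapsTo (fun ζ : ℂ => -ζ) (ball 0 1) (ball 0 1) := fun ζ hζ => by simpa using hζ
  have := Reach.of_two_points (hφ.comp differentiable_neg.differentiableOn hneg)
    (hφm.comp hneg) (a := -s) (b := 0) (by simpa using hs) (by simp)
  simpa [hφ0, hφs] using this
/-- The points reachable from `z` within `s` contain a ball of definite radius after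
`1 - s` is halved. -/
theorem Reach.extend {Ω : Set E} (hΩo : IsOpen Ω) (hΩc : Convex ℝ Ω) {z p p' : E} {s ρ : ℝ}
    (h : Reach Ω z p s) (hs : 1 / 2 ≤ s) (hs1 : s < 1) (hρ : 0 < ρ) (hball : ball p ρ ⊆ Ω)
    (hp : ‖p' - p‖ ≤ ρ / 36) : Reach Ω z p' (1 - (1 - s) / 2) := by
  obtain ⟨ψ, hψ, hψm, hψ0, hψs⟩ := h.symm (by rw [abs_lt]; constructor <;> linarith)
  set a : ℝ := (3 * s - 1) / 2 with ha
  have hh : ∀ ζ ∈ ball (0 : ℂ) 1, (2 * ζ + 1) / 3 ∈ ball (0 : ℂ) 1 ∧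
      ‖1 - ζ‖ ^ 2 / 9 ≤ 1 - ‖(2 * ζ + 1) / 3‖ ∧ 0 < ‖1 - ζ‖ := by
    intro ζ hζ
    rw [mem_ball_zero_iff] at hζ
    have h1 : ζ.re ^ 2 + ζ.im ^ 2 < 1 := by
      have := Complex.normSq_eq_norm_sq ζ
      rw [Complex.normSq_apply] at this
      nlinarith [norm_nonneg ζ]
    have h2 : ‖(2 * ζ + 1) / 3‖ ^ 2 = ((2 * ζ.re + 1) ^ 2 + (2 * ζ.im) ^ 2) / 9 := by
      rw [← Complex.normSq_eq_norm_sq, Complex.normSq_div]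
      simp [Complex.normSq_apply]
      ring
    have h3 : ‖1 - ζ‖ ^ 2 = (1 - ζ.re) ^ 2 + ζ.im ^ 2 := by
      rw [← Complex.normSq_eq_norm_sq]
      simp [Complex.normSq_apply]
      ring
    have hre : ζ.re < 1 := by nlinarith
    have hlt : ‖(2 * ζ + 1) / 3‖ < 1 := by
      nlinarith [norm_nonneg ((2 * ζ + 1) / 3)]
    refine ⟨by simpa using hlt, ?_, ?_⟩
    · nlinarith [norm_nonneg ((2 * ζ + 1) / 3)]
    · rw [norm_pos_iff, sub_ne_zero]
      rintro rfl
      simp at hre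
  have hs0 : (0 : ℝ) < s := by linarith
  have hκ0 : (9 / 4 : ℂ) * (-1 / 2 - a) ≠ 0 := by
    rw [ha]; push_cast
    have : (s : ℂ) ≠ 0 := by exact_mod_cast hs0.ne'
    rw [show (9 / 4 : ℂ) * (-1 / 2 - (3 * s - 1) / 2) = -(27 / 8) * s by ring]
    exact mul_ne_zero (by norm_num) this
  have hκn : 27 / 16 ≤ ‖(9 / 4 : ℂ) * (-1 / 2 - a)‖ := by
    rw [ha]; push_cast
    rw [show (9 / 4 : ℂ) * (-1 / 2 - (3 * s - 1) / 2) = ((-(27 / 8) * s : ℝ) : ℂ) by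
      push_cast; ring, Complex.norm_real, Real.norm_eq_abs, abs_mul, abs_of_pos hs0]
    norm_num
    linarith
  set Φ : ℂ → E := fun ζ => ψ ((2 * ζ + 1) / 3) +
    ((1 - ζ) ^ 2 * (ζ - a) / ((9 / 4 : ℂ) * (-1 / 2 - a))) • (p' - p) with hΦ
  have ha1 : |a| < 1 := by rw [abs_lt]; constructor <;> linarith
  have hΦd : DifferentiableOn ℂ Φ (ball 0 1) := by
    refine DifferentiableOn.add (hψ.comp (by fun_prop) fun ζ hζ => (hh ζ hζ).1) ?_
    exact DifferentiableOn.smul_const (by fun_prop) _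
  have hΦm : MapsTo Φ (ball 0 1) Ω := by
    intro ζ hζ
    obtain ⟨h1, h2, h3⟩ := hh ζ hζ
    refine ball_subset_of_disc hΩo hΩc hψ hψm hρ (by rwa [hψ0]) h1 ?_
    rw [mem_ball, dist_eq_norm, hΦ]
    simp only [add_sub_cancel_left]
    rw [norm_smul, norm_div, norm_mul, norm_pow]
    have h4 : ‖ζ - a‖ ≤ 2 := by
      refine (norm_sub_le _ _).trans ?_
      rw [Complex.norm_real, Real.norm_eq_abs]
      rw [mem_ball_zero_iff] at hζ
      linarith
    have h5 : ‖1 - ζ‖ ^ 2 * ‖ζ - a‖ / ‖(9 / 4 : ℂ) * (-1 / 2 - a)‖ ≤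
        ‖1 - ζ‖ ^ 2 * 2 / (27 / 16) := by gcongr
    have h6 : 0 < ‖1 - ζ‖ ^ 2 := by positivity
    calc _ ≤ ‖1 - ζ‖ ^ 2 * 2 / (27 / 16) * (ρ / 36) := by gcongr
      _ < ρ * (‖1 - ζ‖ ^ 2 / 9) / 2 := by nlinarith [mul_pos hρ h6]
      _ ≤ _ := by gcongr
  have key := (Reach.of_two_points hΦd hΦm (a := -1 / 2) (b := a) (by norm_num [abs_lt]) ha1)
  have e1 : Φ ((-1 / 2 : ℝ) : ℂ) = p' := by
    simp only [hΦ]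
    push_cast
    rw [show (1 - (-1 / 2 : ℂ)) ^ 2 * (-1 / 2 - a) = (9 / 4 : ℂ) * (-1 / 2 - a) by ring,
      div_self hκ0, show ((2 : ℂ) * (-1 / 2) + 1) / 3 = 0 by ring, hψ0]
    simp
  have e2 : Φ a = z := by
    simp only [hΦ]
    rw [show ((2 : ℂ) * a + 1) / 3 = s by rw [ha]; push_cast; ring, hψs]
    simp
  rw [e1, e2] at key
  have hd : (0 : ℝ) < 1 - -1 / 2 * a := by rw [ha]; linarith
  have hσ : (a - -1 / 2) / (1 - -1 / 2 * a) ≤ 1 - (1 - s) / 2 := by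
    rw [div_le_iff₀ hd, ha]; nlinarith
  have hσ0 : 0 ≤ (a - -1 / 2) / (1 - -1 / 2 * a) := div_nonneg (by rw [ha]; linarith) hd.le
  refine (key.mono hσ0 hσ (by linarith)).symm ?_
  rw [abs_lt]; constructor <;> linarith

/-- Reachability from a family of centres at rate `1 - c δ` propagates from one point of a
convex domain to all of its points, locally uniformly. -/
theorem exists_reach_of_reach {Ω : Set E} (hΩo : IsOpen Ω) (hΩc : Convex ℝ Ω) {z : ℝ → E} {m : E}
    (hm : m ∈ Ω) (h : ∀ δ ∈ Ioo (0 : ℝ) 1, Reach Ω (z δ) m (1 - δ)) {p : E} (hp : p ∈ Ω) :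
    ∃ c > 0, ∃ ρ > 0, ∃ δ₀ > 0, ∀ δ ∈ Ioo 0 δ₀, ∀ p' ∈ ball p ρ,
      Reach Ω (z δ) p' (1 - c * δ) := by
  set G : Set E := {p | ∃ c > 0, ∃ ρ > 0, ∃ δ₀ > 0, ∀ δ ∈ Ioo 0 δ₀, ∀ p' ∈ ball p ρ,
      Reach Ω (z δ) p' (1 - c * δ)} with hG
  have step : ∀ q ρ c δ₀, 0 < ρ → 0 < c → 0 < δ₀ → ball q ρ ⊆ Ω →
      (∀ δ ∈ Ioo 0 δ₀, Reach Ω (z δ) q (1 - c * δ)) → ball q (ρ / 36) ⊆ G := by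
    intro q ρ c δ₀ hρ hc hδ₀ hball hq x hx
    rw [mem_ball] at hx
    refine ⟨c / 2, by positivity, ρ / 36 - dist x q, by linarith,
      min δ₀ (1 / (2 * c)), by positivity, fun δ hδ p' hp' => ?_⟩
    have hδ1 : δ < δ₀ := hδ.2.trans_le (min_le_left _ _)
    have hδ2 : δ < 1 / (2 * c) := hδ.2.trans_le (min_le_right _ _)
    rw [lt_div_iff₀ (by positivity)] at hδ2
    have hpos : 0 < c * δ := mul_pos hc hδ.1
    have := (hq δ ⟨hδ.1, hδ1⟩).extend (p' := p') hΩo hΩc (by linarith) (by linarith) hρ hball (by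
      rw [← dist_eq_norm]
      rw [mem_ball] at hp'
      linarith [dist_triangle p' x q])
    convert this using 1
    ring
  have hGo : IsOpen G := by
    rw [Metric.isOpen_iff]
    rintro q ⟨c, hc, ρ, hρ, δ₀, hδ₀, hq⟩
    refine ⟨ρ, hρ, fun x hx => ⟨c, hc, ρ - dist x q, by rw [mem_ball] at hx; linarith, δ₀, hδ₀,
      fun δ hδ p' hp' => hq δ hδ p' ?_⟩⟩
    rw [mem_ball] at hp' ⊢
    linarith [dist_triangle p' x q]
  have hmG : m ∈ G := by
    obtain ⟨ρ, hρ, hb⟩ := Metric.isOpen_iff.1 hΩo m hm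
    refine step m ρ 1 1 hρ one_pos one_pos hb (fun δ hδ => ?_) (mem_ball_self (by positivity))
    simpa using h δ hδ
  refine hΩc.isPreconnected.subset_of_closure_inter_subset hGo ⟨m, hm, hmG⟩ ?_ hp
  rintro q ⟨hq, hqΩ⟩
  obtain ⟨ρ, hρ, hb⟩ := Metric.isOpen_iff.1 hΩo q hqΩ
  obtain ⟨x, hxG, hx⟩ := Metric.mem_closure_iff.1 hq (ρ / 2 / 36) (by positivity)
  obtain ⟨c, hc, ρ', hρ', δ₀, hδ₀, hx'⟩ := hxG
  refine step x (ρ / 2) c δ₀ (by positivity) hc hδ₀ (fun y hy => hb ?_)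
    (fun δ hδ => hx' δ hδ x (mem_ball_self hρ')) hx
  rw [mem_ball] at hy ⊢
  linarith [dist_triangle y x q, dist_comm q x]

theorem slack_mem {Ω : Set E} (hΩc : Convex ℝ Ω) {x u z : E} {ρ e : ℝ} (hx : x ∈ Ω)
    (hball : ball z ρ ⊆ Ω) (he : 0 < e) (heρ : 2 * e ≤ ρ) (hu : ‖u‖ ≤ e) :
    (1 - 2 * e / ρ) • (x + u) + (2 * e / ρ) • z ∈ Ω := by
  have hρ : 0 < ρ := by linarith
  set κ := 2 * e / ρ with hκ
  have hκ0 : 0 < κ := by positivity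
  have hκ1 : κ ≤ 1 := (div_le_one hρ).2 heρ
  have hz : z + ((1 - κ) / κ) • u ∈ Ω := by
    refine hball ?_
    rw [mem_ball, dist_eq_norm, add_sub_cancel_left, norm_smul, Real.norm_of_nonneg
      (div_nonneg (by linarith) hκ0.le)]
    calc (1 - κ) / κ * ‖u‖ ≤ 1 / κ * e := by gcongr; linarith
      _ = ρ / 2 := by rw [hκ]; field_simp
      _ < ρ := by linarith
  have := hΩc hx hz (sub_nonneg.2 hκ1) hκ0.le (by ring)
  convert this using 1
  rw [smul_add, smul_add, smul_smul, mul_div_cancel₀ _ hκ0.ne']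
  abel

/-- A pair of discs `φ`, `ψ` in a convex domain which almost agree to first order at the
origin can be combined with a complex multiplier. -/
theorem Reach.of_pair [CompleteSpace E] {Ω : Set E} (hΩo : IsOpen Ω) (hΩc : Convex ℝ Ω)
    {φ ψ : ℂ → E}
    (hφ : DifferentiableOn ℂ φ (ball 0 1)) (hφm : MapsTo φ (ball 0 1) Ω)
    (hψ : DifferentiableOn ℂ ψ (ball 0 1)) (hψm : MapsTo ψ (ball 0 1) Ω) {ρ e : ℝ}
    (hball : ball (φ 0) ρ ⊆ Ω) (he : 0 < e) (heρ : 2 * e ≤ ρ)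
    (hab : ‖ψ 0 - φ 0‖ + ‖deriv (fun ζ => ψ ζ - φ ζ) 0‖ ≤ e) {ω : ℂ} (hω : ‖ω‖ = 1) {s r : ℝ}
    (hs : 0 < s) (hr : 0 < r) (hr1 : r < 1) :
    Reach Ω (φ 0) ((1 - 2 * e / ρ) • (φ (r * s : ℝ) +
      ((2 + ω * s + ω⁻¹ / s) / 4 : ℂ) • (ψ (r * s : ℝ) - φ (r * s : ℝ) - (ψ 0 - φ 0) -
        ((r * s : ℝ) : ℂ) • deriv (fun ζ => ψ ζ - φ ζ) 0)) + (2 * e / ρ) • φ 0) s := by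
  set F : ℂ → E := fun ζ => ψ ζ - φ ζ with hF
  set b := deriv F 0 with hb
  have hFd : DifferentiableOn ℂ F (ball 0 1) := hψ.sub hφ
  have hnhds : ball (0 : ℂ) 1 ∈ 𝓝 0 := ball_mem_nhds _ one_pos
  set g : ℂ → E := dslope (dslope F 0) 0 with hg
  have hgd : DifferentiableOn ℂ g (ball 0 1) :=
    (Complex.differentiableOn_dslope hnhds).2 ((Complex.differentiableOn_dslope hnhds).2 hFd)
  have hg2 : ∀ ζ, ζ ^ 2 • g ζ = F ζ - F 0 - ζ • b := by
    intro ζ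
    have h1 := sub_smul_dslope F 0 ζ
    have h2 := sub_smul_dslope (dslope F 0) 0 ζ
    rw [dslope_same] at h2
    rw [sub_zero] at h1 h2
    rw [hg, pow_two, mul_smul, h2, smul_sub, h1]
  have hrC : (r : ℂ) ≠ 0 := by exact_mod_cast hr.ne'
  have hsC : (s : ℂ) ≠ 0 := by exact_mod_cast hs.ne'
  have hω0 : ω ≠ 0 := by rintro rfl; simp at hω
  set χ : ℂ → E := fun ζ => φ ζ + ((2 * ζ ^ 2 + ω * ζ ^ 3 / r + ω⁻¹ * r * ζ) / 4 : ℂ) • g ζ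
    with hχ
  have hχd : DifferentiableOn ℂ χ (ball 0 1) :=
    hφ.add (DifferentiableOn.smul (by fun_prop) hgd)
  set X : ℂ → E := fun ζ => (1 - 2 * e / ρ) • χ ζ + (2 * e / ρ) • φ 0 with hX
  have hXd : DifferentiableOn ℂ X (ball 0 1) := (hχd.const_smul _).add_const _
  have hχeq : ∀ ζ : ℂ, ζ ≠ 0 → χ ζ = φ ζ + ((2 + ω * (ζ / r) + ω⁻¹ / (ζ / r)) / 4 : ℂ) •
      (F ζ - F 0 - ζ • b) := by
    intro ζ hζ
    rw [← hg2, smul_smul, hχ]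
    field_simp
  have hsph : MapsTo X (sphere 0 r) Ω := by
    intro ζ hζ
    rw [mem_sphere_zero_iff_norm] at hζ
    have hζ0 : ζ ≠ 0 := by rintro rfl; simp at hζ; exact hr.ne hζ
    have hζ1 : ζ ∈ ball (0 : ℂ) 1 := by simpa [hζ] using hr1
    set u : ℂ := ω * (ζ / r) with hu
    have hun : ‖u‖ = 1 := by
      rw [hu, norm_mul, norm_div, hω, hζ, Complex.norm_real, Real.norm_of_nonneg hr.le,
        div_self hr.ne', mul_one]
    have hu0 : u ≠ 0 := by rintro h; simp [h] at hun
    have hinv : ω⁻¹ / (ζ / r) = u⁻¹ := by rw [hu]; field_simp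
    have hconj : u⁻¹ = (starRingEnd ℂ) u := by
      rw [Complex.inv_def, Complex.normSq_eq_norm_sq, hun]; simp
    set t : ℝ := (1 + u.re) / 2 with ht
    have htu : ((2 + u + u⁻¹) / 4 : ℂ) = (t : ℂ) := by
      rw [hconj, add_assoc, Complex.add_conj, ht]; push_cast; ring
    have hure := abs_le.1 (Complex.abs_re_le_norm u)
    rw [hun] at hure
    have ht0 : 0 ≤ t := by rw [ht]; linarith
    have ht1 : t ≤ 1 := by rw [ht]; linarith
    have hx : (1 - t) • φ ζ + t • ψ ζ ∈ Ω :=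
      hΩc (hφm hζ1) (hψm hζ1) (sub_nonneg.2 ht1) ht0 (by ring)
    have hle : ‖-(t • (F 0 + ζ • b))‖ ≤ e := by
      rw [norm_neg, norm_smul, Real.norm_of_nonneg ht0]
      have h1 : ‖F 0 + ζ • b‖ ≤ e := by
        refine (norm_add_le _ _).trans (le_trans ?_ hab)
        rw [norm_smul, hζ]
        have := mul_le_of_le_one_left (norm_nonneg b) hr1.le
        simp only [hF]
        gcongr
      calc t * ‖F 0 + ζ • b‖ ≤ 1 * e := by gcongr
        _ = e := one_mul e
    have := slack_mem hΩc hx hball he heρ hle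
    convert this using 3
    rw [hχeq ζ hζ0, hinv, htu, hF]
    simp only [sub_smul, one_smul, smul_sub, smul_add, Complex.coe_smul]
    abel
  have hcl : closure (ball (0 : ℂ) r) ⊆ ball 0 1 := by
    rw [closure_ball _ hr.ne']
    exact closedBall_subset_ball hr1
  have hXm : MapsTo X (ball 0 r) Ω :=
    mapsTo_of_mapsTo_sphere hΩo hΩc hr (hXd.mono hcl).diffContOnCl hsph
  have hscale : MapsTo (fun ζ : ℂ => (r : ℂ) * ζ) (ball 0 1) (ball 0 r) := by
    intro ζ hζ
    rw [mem_ball_zero_iff] at hζ ⊢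
    rw [norm_mul, Complex.norm_real, Real.norm_of_nonneg hr.le]
    nlinarith
  refine ⟨fun ζ => X (r * ζ), hXd.comp (by fun_prop)
    (hscale.mono_right (ball_subset_ball hr1.le)), hXm.comp hscale, ?_, ?_⟩
  · simp only [hX, hχ, mul_zero]
    simp [← add_smul]
  · simp only [hX]
    rw [hχeq _ (mul_ne_zero hrC hsC), mul_div_cancel_left₀ _ hrC]
    push_cast
    rfl

theorem norm_mul_sq_le_of_re_multiplier_le {L : ℂ} {K s : ℝ} (hs : 1 / 2 ≤ s) (hs1 : s < 1)
    (h : ∀ ω : ℂ, ‖ω‖ = 1 → ((2 + ω * s + ω⁻¹ / s) / 4 * L : ℂ).re ≤ K) :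
    ‖L‖ * (1 - s) ^ 2 ≤ 16 * K := by
  have hs0 : 0 < s := by linarith
  have hsC : (s : ℂ) ≠ 0 := by exact_mod_cast hs0.ne'
  have h1 : (2 + s + 1 / s) / 4 * L.re ≤ K := by
    have := h 1 (by simp)
    rw [show (2 + 1 * (s : ℂ) + 1⁻¹ / s) / 4 = (((2 + s + 1 / s) / 4 : ℝ) : ℂ) by
      push_cast; ring, Complex.re_ofReal_mul] at this
    exact this
  have h2 : -((1 - s) ^ 2 / (4 * s)) * L.re ≤ K := by
    have := h (-1) (by simp)
    rw [show (2 + -1 * (s : ℂ) + (-1)⁻¹ / s) / 4 = ((-((1 - s) ^ 2 / (4 * s)) : ℝ) : ℂ) by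
      push_cast; field_simp; ring, Complex.re_ofReal_mul] at this
    exact this
  have h3 : ∀ σ : ℝ, σ ^ 2 = 1 → -(σ * ((1 - s ^ 2) ^ 2 / (4 * s * (1 + s ^ 2)))) * L.im ≤ K := by
    intro σ hσ
    set ω : ℂ := ⟨-(2 * s / (1 + s ^ 2)), -(σ * ((1 - s ^ 2) / (1 + s ^ 2)))⟩ with hω
    have hp : (1 + s ^ 2 : ℝ) ≠ 0 := by positivity
    have hnsq : Complex.normSq ω = 1 := by
      rw [hω, Complex.normSq_mk]
      field_simp
      rw [hσ]; ring
    have hn : ‖ω‖ = 1 := by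
      have := Complex.normSq_eq_norm_sq ω
      rw [hnsq] at this
      nlinarith [norm_nonneg ω]
    have := h ω hn
    rw [Complex.inv_def, hnsq] at this
    obtain ⟨T, hT⟩ : ∃ T, T = (1 - s ^ 2) ^ 2 / (4 * s * (1 + s ^ 2)) := ⟨_, rfl⟩
    have e : (2 + ω * s + (starRingEnd ℂ) ω * ((1⁻¹ : ℝ) : ℂ) / s) / 4 =
        ((σ * T : ℝ) : ℂ) * Complex.I := by
      have e1 : (starRingEnd ℂ) ω * ((1⁻¹ : ℝ) : ℂ) / s = ((1 / s : ℝ) : ℂ) * (starRingEnd ℂ) ω := by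
        push_cast; ring
      rw [e1, show (4 : ℂ) = ((4 : ℝ) : ℂ) by norm_num]
      apply Complex.ext
      · rw [Complex.div_ofReal_re]
        simp [hω]
        field_simp
        ring
      · rw [Complex.div_ofReal_im]
        simp [hω]
        rw [hT]
        field_simp
        ring
    rw [e] at this
    rw [← hT]
    simpa using this
  have h0 : 0 ≤ (1 - s) ^ 2 := by positivity
  have hh1 : (1 - s) ^ 2 ≤ 1 := by nlinarith
  have hK : 0 ≤ K := by
    rcases le_total 0 L.re with hL | hL
    · exact (mul_nonneg (by positivity) hL).trans h1
    · exact (mul_nonneg_of_nonpos_of_nonpos (by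
        have : 0 ≤ (1 - s) ^ 2 / (4 * s) := by positivity
        linarith) hL).trans h2
  have hre : |L.re| * (1 - s) ^ 2 ≤ 8 * K := by
    rcases le_total 0 L.re with hL | hL
    · rw [abs_of_nonneg hL]
      have : 1 ≤ (2 + s + 1 / s) / 4 := by
        have : 1 ≤ 1 / s := by rw [le_div_iff₀ hs0]; linarith
        have : 2 ≤ s + 1 / s := by
          rw [← sub_nonneg, show s + 1 / s - 2 = (1 - s) ^ 2 / s by field_simp; ring]
          positivity
        linarith
      nlinarith
    · rw [abs_of_nonpos hL]
      have : (1 - s) ^ 2 / 4 ≤ (1 - s) ^ 2 / (4 * s) := by 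
        gcongr
        linarith
      nlinarith
  have him : |L.im| * (1 - s) ^ 2 ≤ 8 * K := by
    have hk : (1 - s) ^ 2 / 8 ≤ (1 - s ^ 2) ^ 2 / (4 * s * (1 + s ^ 2)) := by
      rw [div_le_div_iff₀ (by positivity) (by positivity)]
      have : (1 - s ^ 2) ^ 2 = (1 - s) ^ 2 * (1 + s) ^ 2 := by ring
      rw [this, mul_assoc]
      have hs3 : s * (1 + s ^ 2) ≤ 2 := by nlinarith
      gcongr <;> nlinarith
    have ha := h3 1 (by norm_num)
    have hb := h3 (-1) (by norm_num)
    rcases le_total 0 L.im with hL | hL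
    · rw [abs_of_nonneg hL]
      nlinarith
    · rw [abs_of_nonpos hL]
      nlinarith
  calc ‖L‖ * (1 - s) ^ 2 ≤ (|L.re| + |L.im|) * (1 - s) ^ 2 := by
        gcongr; exact Complex.norm_le_abs_re_add_abs_im L
    _ ≤ 16 * K := by linarith

/-- A functional supporting the set reachable from `z` within `s` at `q` is almost orthogonal
to the displacement between two discs that almost agree to first order at the origin. -/
theorem norm_apply_mul_sq_le_of_support [CompleteSpace E] {Ω : Set E} (hΩo : IsOpen Ω)
    (hΩc : Convex ℝ Ω) {φ ψ : ℂ → E}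
    (hφ : DifferentiableOn ℂ φ (ball 0 1)) (hφm : MapsTo φ (ball 0 1) Ω)
    (hψ : DifferentiableOn ℂ ψ (ball 0 1)) (hψm : MapsTo ψ (ball 0 1) Ω) {ρ e M τ : ℝ}
    (hball : ball (φ 0) ρ ⊆ Ω) (he : 0 < e) (heρ : 4 * e ≤ ρ)
    (hab : ‖ψ 0 - φ 0‖ + ‖deriv (fun ζ => ψ ζ - φ ζ) 0‖ ≤ e) {s r : ℝ}
    (hs : 1 / 2 ≤ s) (hs1 : s < 1) (hr : 0 < r) (hr1 : r < 1) {q v : E}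
    (hφq : ‖φ (r * s : ℝ) - q‖ ≤ τ) (hψq : ‖ψ (r * s : ℝ) - (q + v)‖ ≤ τ)
    (hM : ‖φ 0 - q‖ ≤ M) {L : E →L[ℂ] ℂ}
    (hL : ∀ p, Reach Ω (φ 0) p s → (L p).re ≤ (L q).re) :
    ‖L v‖ * (1 - s) ^ 2 ≤ 16 * (‖L‖ * (10 * τ + 4 * e + 4 * e * M / ρ)) := by
  have hs0 : 0 < s := by linarith
  refine norm_mul_sq_le_of_re_multiplier_le hs hs1 fun ω hω => ?_
  have hR := hL _ (Reach.of_pair hΩo hΩc hφ hφm hψ hψm hball he (by linarith) hab hω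
    hs0 hr hr1)
  set a := ψ 0 - φ 0
  set b := deriv (fun ζ => ψ ζ - φ ζ) 0
  set t : ℂ := (2 + ω * s + ω⁻¹ / s) / 4 with ht
  have htn : ‖t‖ ≤ 2 := by
    rw [ht, norm_div]
    have h1 : ‖(2 + ω * s + ω⁻¹ / s : ℂ)‖ ≤ 2 + s + 1 / s := by
      refine (norm_add₃_le).trans ?_
      simp [hω, abs_of_pos hs0]
    have h2 : 1 / s ≤ 2 := by rw [div_le_iff₀ hs0]; linarith
    have h3 : ‖(4 : ℂ)‖ = 4 := by simp
    rw [h3, div_le_iff₀ (by norm_num)]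
    linarith
  have hρ : 0 < ρ := by linarith
  set κ := 2 * e / ρ with hκ
  have hκ0 : 0 < κ := by positivity
  have hκ2 : κ ≤ 1 / 2 := by rw [hκ, div_le_iff₀ hρ]; linarith
  set x := φ (r * s : ℝ)
  set y := ψ (r * s : ℝ)
  have hτ : 0 ≤ τ := (norm_nonneg _).trans hφq
  have hM0 : 0 ≤ M := (norm_nonneg _).trans hM
  set w : E := (1 - κ) • ((x - q) + t • ((y - (q + v)) - (x - q) - (a + ((r * s : ℝ) : ℂ) • b))) +
    κ • (φ 0 - q) with hw
  have hdec : (1 - κ) • (x + t • (y - x - a - ((r * s : ℝ) : ℂ) • b)) + κ • φ 0 =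
      q + (1 - κ) • (t • v) + w := by
    rw [hw]
    simp only [smul_add, smul_sub, sub_smul, one_smul]
    abel
  rw [hdec, map_add, map_add, Complex.add_re, Complex.add_re] at hR
  have hLs : (L ((1 - κ) • (t • v))).re = (1 - κ) * (t * L v).re := by
    rw [← Complex.coe_smul, map_smul, map_smul, smul_eq_mul, smul_eq_mul, Complex.re_ofReal_mul]
  rw [hLs] at hR
  have hwn : ‖w‖ ≤ 5 * τ + 2 * e + κ * M := by
    have h1 : ‖a + ((r * s : ℝ) : ℂ) • b‖ ≤ e := by
      refine (norm_add_le _ _).trans (le_trans ?_ hab)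
      rw [norm_smul, Complex.norm_real, Real.norm_of_nonneg (by positivity)]
      have := mul_le_of_le_one_left (norm_nonneg b) (by nlinarith : r * s ≤ 1)
      linarith
    have h2 : ‖(y - (q + v)) - (x - q) - (a + ((r * s : ℝ) : ℂ) • b)‖ ≤ 2 * τ + e := by
      refine (norm_sub_le _ _).trans ?_
      have := norm_sub_le (y - (q + v)) (x - q)
      linarith
    have h3 : ‖(x - q) + t • ((y - (q + v)) - (x - q) - (a + ((r * s : ℝ) : ℂ) • b))‖ ≤
        τ + 2 * (2 * τ + e) := by
      refine (norm_add_le _ _).trans ?_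
      rw [norm_smul]
      gcongr
    refine (norm_add_le _ _).trans ?_
    rw [norm_smul, norm_smul, Real.norm_of_nonneg hκ0.le, Real.norm_of_nonneg (by linarith)]
    have h4 := mul_le_of_le_one_left (norm_nonneg
      ((x - q) + t • ((y - (q + v)) - (x - q) - (a + ((r * s : ℝ) : ℂ) • b))))
      (by linarith : 1 - κ ≤ 1)
    have h5 : κ * ‖φ 0 - q‖ ≤ κ * M := by gcongr
    linarith
  have hLw : -(‖L‖ * (5 * τ + 2 * e + κ * M)) ≤ (L w).re := by
    have h1 := (abs_le.1 (Complex.abs_re_le_norm (L w))).1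
    have h2 := (L.le_opNorm w).trans (mul_le_mul_of_nonneg_left hwn (norm_nonneg L))
    linarith
  have hfin : (1 - κ) * (t * L v).re ≤ ‖L‖ * (5 * τ + 2 * e + κ * M) := by linarith
  have hrhs : ‖L‖ * (10 * τ + 4 * e + 4 * e * M / ρ) = 2 * (‖L‖ * (5 * τ + 2 * e + κ * M)) := by
    rw [hκ]; ring
  rw [hrhs]
  have : 0 ≤ ‖L‖ * (5 * τ + 2 * e + κ * M) := by positivity
  rcases le_total 0 (t * L v).re with h | h
  · nlinarith
  · linarith

/-- If `f` agrees with the identity to fourth order near `ξ`, then so do `f ∘ φ` and `φ`, to first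
order at the origin, for discs `φ` centred near `ξ`. -/
theorem norm_add_norm_deriv_le_of_disc [CompleteSpace E] {Ω : Set E} {f : E → E}
    (hf : DifferentiableOn ℂ f Ω) {M ε σ d : ℝ} (hM : ∀ x ∈ Ω, ∀ y ∈ Ω, ‖x - y‖ ≤ M) {ξ : E}
    (hσ : ∀ w ∈ Ω, ‖w - ξ‖ < σ → ‖f w - w‖ ≤ ε * ‖w - ξ‖ ^ 4) (hε : 0 ≤ ε) {φ : ℂ → E}
    (hφ : DifferentiableOn ℂ φ (ball 0 1)) (hφm : MapsTo φ (ball 0 1) Ω)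
    (hd : ‖φ 0 - ξ‖ = d) (hd0 : 0 < d) (hdσ : 2 * d < σ) (hdM : d < M) :
    ‖f (φ 0) - φ 0‖ + ‖deriv (fun ζ => f (φ ζ) - φ ζ) 0‖ ≤ 17 * ε * M * d ^ 3 := by
  have hM0 : 0 < M := hd0.trans hdM
  have h0 : (0 : ℂ) ∈ ball (0 : ℂ) 1 := by simp
  have hFd : DifferentiableOn ℂ (fun ζ => f (φ ζ) - φ ζ) (ball 0 1) := (hf.comp hφ hφm).sub hφ
  set ν := d / M with hν
  have hν0 : 0 < ν := by positivity
  have hν1 : ν < 1 := (div_lt_one hM0).2 hdM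
  have hbound : ∀ ζ ∈ sphere (0 : ℂ) ν, ‖f (φ ζ) - φ ζ‖ ≤ ε * (2 * d) ^ 4 := by
    intro ζ hζ
    rw [mem_sphere_zero_iff_norm] at hζ
    have hζ1 : ζ ∈ ball (0 : ℂ) 1 := by simpa [hζ] using hν1
    have h1 : dist (φ ζ) (φ 0) ≤ M / 1 * dist ζ 0 :=
      Complex.dist_le_div_mul_dist_of_mapsTo_ball hφ (fun w hw => by
        rw [mem_closedBall, dist_eq_norm]
        exact hM _ (hφm hw) _ (hφm h0)) hζ1
    rw [dist_zero_right, hζ, div_one, hν, mul_div_cancel₀ _ hM0.ne', dist_eq_norm] at h1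
    have h2 : ‖φ ζ - ξ‖ ≤ 2 * d := by
      have := norm_sub_le_norm_sub_add_norm_sub (φ ζ) (φ 0) ξ
      linarith
    refine (hσ _ (hφm hζ1) (h2.trans_lt hdσ)).trans ?_
    gcongr
  have hcl : closure (ball (0 : ℂ) ν) ⊆ ball 0 1 := by
    rw [closure_ball _ hν0.ne']
    exact closedBall_subset_ball hν1
  have h3 := Complex.norm_deriv_le_of_forall_mem_sphere_norm_le hν0
    (hFd.mono hcl).diffContOnCl hbound
  have h4 := hσ (φ 0) (hφm h0) (by rw [hd]; linarith)
  rw [hd] at h4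
  have h5 : ε * (2 * d) ^ 4 / ν = 16 * ε * M * d ^ 3 := by
    rw [hν]; field_simp; ring
  have h6 : ε * d ^ 4 ≤ ε * M * d ^ 3 := by
    have : ε * d ^ 4 = ε * d * d ^ 3 := by ring
    rw [this]
    gcongr
  linarith

theorem exists_lt_sub_lt_of_not {P : ℝ → Prop} {a b γ : ℝ} (ha : ¬ P a) (hb : P b) (hab : a < b)
    (hγ : 0 < γ) : ∃ s t, a ≤ s ∧ s < t ∧ t ≤ b ∧ t - s < γ ∧ ¬ P s ∧ P t := by
  set A : Set ℝ := {t | a ≤ t ∧ t ≤ b ∧ P t} with hA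
  have hbdd : BddBelow A := ⟨a, fun t ht => ht.1⟩
  obtain ⟨t, ⟨hat, htb, htP⟩, ht⟩ := exists_lt_of_csInf_lt (s := A) ⟨b, hab.le, le_rfl, hb⟩
    (lt_add_of_pos_right (sInf A) (half_pos hγ))
  rcases le_or_gt (t - γ / 2) a with h | h
  · refine ⟨a, t, le_rfl, lt_of_le_of_ne hat ?_, htb, by linarith, ha, htP⟩
    rintro rfl
    exact ha htP
  · refine ⟨t - γ / 2, t, h.le, by linarith, htb, by linarith, fun hP => ?_, htP⟩
    have := csInf_le hbdd (show t - γ / 2 ∈ A from ⟨h.le, by linarith, hP⟩)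
    linarith

theorem norm_sub_le_of_mem_disc {Ω : Set E} {M : ℝ} (hM : ∀ x ∈ Ω, ∀ y ∈ Ω, ‖x - y‖ ≤ M)
    {φ : ℂ → E} (hφ : DifferentiableOn ℂ φ (ball 0 1)) (hφm : MapsTo φ (ball 0 1) Ω) {s t : ℝ}
    (hs : 0 ≤ s) (hst : |t - s| < 1 - s) : ‖φ t - φ s‖ ≤ M / (1 - s) * |t - s| := by
  have hsub : ball (s : ℂ) (1 - s) ⊆ ball 0 1 := by
    refine ball_subset_ball' ?_
    rw [dist_zero_right, Complex.norm_real, Real.norm_of_nonneg hs]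
    linarith
  have hpos : 0 < 1 - s := (abs_nonneg _).trans_lt hst
  have hdist : dist (t : ℂ) s = |t - s| := by
    rw [dist_eq_norm, ← Complex.ofReal_sub, Complex.norm_real, Real.norm_eq_abs]
  have := Complex.dist_le_div_mul_dist_of_mapsTo_ball (hφ.mono hsub) (R₂ := M) (c := (s : ℂ)) (z := (t : ℂ))
    (fun w hw => by
      rw [mem_closedBall, dist_eq_norm]
      exact hM _ (hφm (hsub hw)) _ (hφm (hsub (mem_ball_self hpos)))) (by
      rw [mem_ball, hdist]; exact hst)
  rwa [hdist, dist_eq_norm] at this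

/-- If the displacement of `f` is of fourth order at `ξ`, then for points `q` which are farther
than `p` from `ξ`, there is a functional separating `q` from `p` which is almost orthogonal to the
displacement of `q`. -/
theorem exists_separating_almost_orthogonal [CompleteSpace E] {Ω : Set E} (hΩo : IsOpen Ω)
    (hΩc : Convex ℝ Ω) {f : E → E} (hf : DifferentiableOn ℂ f Ω) (hfm : MapsTo f Ω Ω)
    {M ε σ R c C ρ : ℝ} (hM0 : 0 < M) (hM : ∀ x ∈ Ω, ∀ y ∈ Ω, ‖x - y‖ ≤ M) {ξ : E}
    (hσ0 : 0 < σ) (hσ : ∀ w ∈ Ω, ‖w - ξ‖ < σ → ‖f w - w‖ ≤ ε * ‖w - ξ‖ ^ 4) (hε : 0 < ε)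
    (hR : 0 < R) (hc : 0 < c) (hρ : 0 < ρ) {z : ℝ → E} {p q : E} (hq : q ∈ Ω)
    (hz : ∀ᶠ δ in 𝓝[>] 0, ‖z δ - ξ‖ = δ * R ∧ ball (z δ) (δ * R) ⊆ Ω)
    (hzq : ∀ᶠ δ in 𝓝[>] 0, Reach Ω (z δ) q (1 - c * δ))
    (hzp : ∀ᶠ δ in 𝓝[>] 0, ∀ x ∈ ball p ρ, Reach Ω (z δ) x (1 - C * δ))
    (hlow : ∀ᶠ δ in 𝓝[>] 0, ∀ s, 0 < s → s < 1 → Reach Ω (z δ) q s → 1 - s < C * δ) :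
    ∃ L : E →L[ℂ] ℂ, L ≠ 0 ∧ ρ * ‖L‖ ≤ (L q).re - (L p).re ∧
      ‖L (f q - q)‖ * c ^ 2 ≤ 16 * (‖L‖ * (ε * (10 + 68 * M * R ^ 3 + 68 * M ^ 2 * R ^ 2))) := by
  have small : ∀ (a b : ℝ), 0 < b → ∀ᶠ δ in 𝓝[>] (0 : ℝ), a * δ < b := by
    intro a b hb
    have : Tendsto (fun δ : ℝ => a * δ) (𝓝[>] 0) (𝓝 (a * 0)) :=
      (tendsto_id.const_mul a).mono_left nhdsWithin_le_nhds
    rw [mul_zero] at this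
    exact this.eventually (gt_mem_nhds hb)
  obtain ⟨δ, ⟨hz1, hzb⟩, hzq, hzp, hlow, hδ0, hδ1, hδσ, hδM, hδC, hδc, hδe⟩ :=
    (hz.and <| hzq.and <| hzp.and <| hlow.and <| (eventually_mem_nhdsWithin).and <|
      (small 1 1 one_pos).and <| (small (2 * R) σ hσ0).and <| (small R M hM0).and <|
      (small C (1 / 2) (by norm_num)).and <| (small c 1 one_pos).and
      (small (68 * ε * M * R ^ 2) 1 one_pos)).exists
  replace hδ0 : 0 < δ := hδ0
  rw [one_mul] at hδ1
  have hcδ : 0 < c * δ := mul_pos hc hδ0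
  have hδR : 0 < δ * R := mul_pos hδ0 hR
  have hlt : c * δ < C * δ := by
    have := hlow _ (by linarith) (by linarith) hzq
    linarith
  have hlo : ¬ Reach Ω (z δ) q (1 - C * δ) := fun h => by
    have := hlow _ (by linarith) (by linarith) h
    linarith
  set τ := ε * δ ^ 2 with hτ
  have hτ0 : 0 < τ := by positivity
  have hcont : ContinuousAt f q := (hf.continuousOn).continuousAt (hΩo.mem_nhds hq)
  obtain ⟨β, hβ0, hβ⟩ := Metric.continuousAt_iff.1 hcont τ hτ0
  set γ := min (min β τ * (c * δ) / (4 * M)) (c * δ / 4) with hγ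
  have hγ0 : 0 < γ := by positivity
  have hγ1 : γ ≤ c * δ / 4 := min_le_right _ _
  have hγ2 : γ ≤ min β τ * (c * δ) / (4 * M) := min_le_left _ _
  obtain ⟨s, s₁, hs_lo, hss, hs₁, hsγ, hsn, φ, hφ, hφm, hφ0, hφs⟩ :=
    exists_lt_sub_lt_of_not hlo hzq (by linarith) hγ0
  have hs_half : 1 / 2 ≤ s := by linarith
  have hs_one : s < 1 := by linarith
  set r := 1 - γ with hr
  have hr0 : 0 < r := by rw [hr]; linarith
  have hr1 : r < 1 := by rw [hr]; linarith
  have hrs : |r * s - s₁| < 2 * γ := by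
    rw [abs_lt, hr]; constructor <;> nlinarith
  have hnear : ‖φ (r * s : ℝ) - q‖ < min β τ := by
    have h1 := norm_sub_le_of_mem_disc hM hφ hφm (s := s₁) (t := r * s) (by linarith) (by linarith)
    rw [hφs] at h1
    refine h1.trans_lt ?_
    have hpos : 0 < min β τ := lt_min hβ0 hτ0
    calc M / (1 - s₁) * |r * s - s₁| ≤ M / (c * δ) * (2 * γ) := by
          gcongr
          linarith
      _ ≤ M / (c * δ) * (2 * (min β τ * (c * δ) / (4 * M))) := by gcongr
      _ = min β τ / 2 := by field_simp; norm_num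
      _ < min β τ := by linarith
  have hfnear : ‖f (φ (r * s : ℝ)) - (q + (f q - q))‖ ≤ τ := by
    rw [add_sub_cancel, ← dist_eq_norm]
    exact (hβ (by rw [dist_eq_norm]; exact hnear.trans_le (min_le_left _ _))).le
  have hball : ball p ρ ⊆ {x | Reach Ω (z δ) x s} := fun x hx =>
    (hzp x hx).mono (by linarith) hs_lo (by linarith)
  have hqint : q ∉ interior {x | Reach Ω (z δ) x s} := fun h => by
    have h2 : q ∈ {x | Reach Ω (z δ) x s} := interior_subset h
    exact hsn h2
  have hinterior : (interior {x | Reach Ω (z δ) x s}).Nonempty :=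
    ⟨p, interior_mono hball (by rw [isOpen_ball.interior_eq]; exact mem_ball_self hρ)⟩
  obtain ⟨L, hL0, hL⟩ := RCLike.geometric_hahn_banach_of_nonempty_interior_point (𝕜 := ℂ)
    (Reach.convex hΩc (z δ) s) hqint hinterior
  simp only [RCLike.re_eq_complex_re] at hL
  have hLp := opNorm_mul_le_of_ball_subset hρ fun x hx => hL x (hball hx)
  set e := 17 * ε * M * (δ * R) ^ 3 with he
  have he0 : 0 < e := by positivity
  have heR : 4 * e ≤ δ * R := by
    have h1 : 4 * e = (68 * ε * M * R ^ 2 * δ) * δ * (δ * R) := by rw [he]; ring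
    rw [h1]
    have : (68 * ε * M * R ^ 2 * δ) * δ ≤ 1 := mul_le_one₀ hδe.le hδ0.le hδ1.le
    exact mul_le_of_le_one_left hδR.le this
  have hab := norm_add_norm_deriv_le_of_disc hf hM hσ hε.le hφ hφm (d := δ * R) (by rw [hφ0, hz1])
    hδR (by linarith) (by linarith)
  have hφz : z δ ∈ Ω := hφ0 ▸ hφm (mem_ball_self one_pos)
  have key := norm_apply_mul_sq_le_of_support hΩo hΩc hφ hφm (hf.comp hφ hφm) (hfm.comp hφm)
    (by rwa [hφ0]) he0 heR hab hs_half hs_one hr0 hr1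
    (hnear.le.trans (min_le_right _ _)) hfnear (by rw [hφ0]; exact hM _ hφz _ hq)
    (M := M) (L := L) (by rw [hφ0]; exact hL)
  refine ⟨L, hL0, hLp, ?_⟩
  have h1 : (c * δ) ^ 2 ≤ (1 - s) ^ 2 := pow_le_pow_left₀ hcδ.le (by linarith) 2
  have h2 : 10 * τ + 4 * e + 4 * e * M / (δ * R) ≤
      δ ^ 2 * (ε * (10 + 68 * M * R ^ 3 + 68 * M ^ 2 * R ^ 2)) := by
    have h3 : 4 * e * M / (δ * R) = 68 * ε * M ^ 2 * R ^ 2 * δ ^ 2 := by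
      rw [he]; field_simp; ring
    have h4 : 4 * e ≤ 68 * ε * M * R ^ 3 * δ ^ 2 := by
      have : 4 * e = 68 * ε * M * R ^ 3 * δ ^ 2 * δ := by rw [he]; ring
      rw [this]
      exact mul_le_of_le_one_right (by positivity) hδ1.le
    rw [h3, hτ]
    linarith
  have h5 : ‖L (f q - q)‖ * (c * δ) ^ 2 ≤
      16 * (‖L‖ * (δ ^ 2 * (ε * (10 + 68 * M * R ^ 3 + 68 * M ^ 2 * R ^ 2)))) :=
    (mul_le_mul_of_nonneg_left h1 (norm_nonneg _)).trans (key.trans (by gcongr))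
  have hδ2 : 0 < δ ^ 2 := by positivity
  refine le_of_mul_le_mul_right ?_ hδ2
  calc _ = ‖L (f q - q)‖ * (c * δ) ^ 2 := by ring
    _ ≤ _ := h5
    _ = _ := by ring

theorem Reach.norm_mul_le {Ω : Set E} {z p y : E} {s : ℝ} (h : Reach Ω z p s) (hs : |s| < 1)
    {L : E →L[ℂ] ℂ} (hL : ∀ x ∈ Ω, 0 < (L (y - x)).re) :
    ‖L (y - p)‖ * (1 - |s|) ≤ 2 * ‖L (y - z)‖ := by
  obtain ⟨φ, hφ, hφm, hφ0, hφs⟩ := h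
  have hn : ‖(s : ℂ)‖ = |s| := by rw [Complex.norm_real, Real.norm_eq_abs]
  have := norm_mul_le_of_re_pos (g := fun ζ => L (y - φ ζ))
    (L.differentiable.comp_differentiableOn (hφ.const_sub y)) (fun ζ hζ => hL _ (hφm hζ))
    (ζ := s) (by rwa [mem_ball_zero_iff, hn])
  rwa [hn, hφs, hφ0] at this

/-- A lower bound for the distance from `z` to `q` when `z` and `q` approach boundary points
which do not lie in a common complex supporting hyperplane. -/
theorem Reach.one_sub_le {Ω : Set E} {z q ξ η : E} {s r₀ N δ : ℝ} (h : Reach Ω z q s) (hs : 0 < s)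
    (hs1 : s < 1) {A B : E →L[ℂ] ℂ} (hA : ∀ x ∈ Ω, 0 < (A (ξ - x)).re)
    (hB : ∀ x ∈ Ω, 0 < (B (η - x)).re) (hAB : ∀ x ∈ Ω, r₀ ≤ ‖A (ξ - x)‖ ∨ r₀ ≤ ‖B (η - x)‖)
    (hδ : 0 < δ) (hN : 0 < N) (hNδ : N * δ ≤ 1 / 2) (hz : 2 * ‖A (ξ - z)‖ < r₀ * (N * δ))
    (hq : ‖B (η - q)‖ < r₀) : r₀ * (1 - s) ≤ 4 * ‖B (η - q)‖ * (N * δ) := by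
  have hNδ0 : 0 < N * δ := mul_pos hN hδ
  have hqΩ : q ∈ Ω := by
    obtain ⟨φ, -, hφm, -, rfl⟩ := h
    exact hφm (by rw [mem_ball_zero_iff, Complex.norm_real, Real.norm_of_nonneg hs.le]; exact hs1)
  have hsx : 1 - N * δ < s := by
    by_contra! hle
    have h1 := h.norm_mul_le (by rwa [abs_of_pos hs]) hA
    rw [abs_of_pos hs] at h1
    have h2 : r₀ ≤ ‖A (ξ - q)‖ := (hAB q hqΩ).resolve_right hq.not_ge
    have h3 : ‖A (ξ - q)‖ * (N * δ) ≤ ‖A (ξ - q)‖ * (1 - s) := by gcongr; linarith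
    have h4 : r₀ * (N * δ) ≤ ‖A (ξ - q)‖ * (N * δ) := by gcongr
    linarith
  obtain ⟨φ, hφ, hφm, hφ0, hφs⟩ := h
  set x := 1 - N * δ with hx
  have hx0 : 0 < x := by linarith
  have hx1 : x < 1 := by linarith
  have hzx := Reach.norm_mul_le (z := z) (p := φ x) ⟨φ, hφ, hφm, hφ0, rfl⟩
    (by rwa [abs_of_pos hx0]) hA
  rw [abs_of_pos hx0] at hzx
  have hφx : φ x ∈ Ω :=
    hφm (by rw [mem_ball_zero_iff, Complex.norm_real, Real.norm_of_nonneg hx0.le]; exact hx1)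
  have hBx : r₀ ≤ ‖B (η - φ x)‖ := by
    refine (hAB _ hφx).resolve_left fun hle => ?_
    have : r₀ * (N * δ) ≤ ‖A (ξ - φ x)‖ * (1 - x) := by
      rw [show 1 - x = N * δ by rw [hx]; ring]
      gcongr
    linarith
  have hqx := Reach.of_two_points hφ hφm (a := s) (b := x) (by rwa [abs_of_pos hs])
    (by rwa [abs_of_pos hx0])
  rw [hφs] at hqx
  have hd : 0 < 1 - s * x := by nlinarith
  have habs : |(x - s) / (1 - s * x)| = (s - x) / (1 - s * x) := by
    rw [abs_div, abs_of_pos hd, abs_sub_comm, abs_of_pos (by linarith)]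
  have hval : 1 - (s - x) / (1 - s * x) = (1 - s) * (1 + x) / (1 - s * x) := by
    rw [eq_div_iff hd.ne', sub_mul, div_mul_cancel₀ _ hd.ne']; ring
  have hpos : 0 < (1 - s) * (1 + x) / (1 - s * x) :=
    div_pos (mul_pos (by linarith) (by linarith)) hd
  have h1 := hqx.norm_mul_le (by rw [habs]; linarith) hB
  rw [habs, hval, mul_div_assoc', div_le_iff₀ hd] at h1
  have h2 : r₀ * (1 - s) ≤ ‖B (η - φ x)‖ * ((1 - s) * (1 + x)) := by
    have : (1 - s) * 1 ≤ (1 - s) * (1 + x) := by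
      apply mul_le_mul_of_nonneg_left <;> linarith
    rw [mul_one] at this
    gcongr
  have h3 : 1 - s * x ≤ 2 * (N * δ) := by nlinarith
  calc r₀ * (1 - s) ≤ 2 * ‖B (η - q)‖ * (1 - s * x) := h2.trans h1
    _ ≤ 2 * ‖B (η - q)‖ * (2 * (N * δ)) := by gcongr
    _ = _ := by ring

/-- A holomorphic self-map of a bounded convex domain which agrees with the identity to fourth
order at `ξ` cannot move points near `η` across the domain along a complex line. -/
theorem false_of_displacement [CompleteSpace E] {Ω : Set E} (hΩo : IsOpen Ω)
    (hΩc : Convex ℝ Ω) {f : E → E} (hf : DifferentiableOn ℂ f Ω) (hfm : MapsTo f Ω Ω)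
    {M R r₀ : ℝ} (hM0 : 0 < M) (hM : ∀ x ∈ Ω, ∀ y ∈ Ω, ‖x - y‖ ≤ M) {ξ η ζ m : E} (hξ : ξ ∉ Ω)
    (hlim : Tendsto (fun z => ‖f z - z‖ / ‖z - ξ‖ ^ 4) (𝓝[Ω] ξ) (𝓝 0))
    (hR : 0 < R) {z : ℝ → E} (hm : m ∈ Ω) (hzξ : ∀ δ ∈ Ioo (0 : ℝ) 1, ‖z δ - ξ‖ = δ * R)
    (hzball : ∀ δ ∈ Ioo (0 : ℝ) 1, ball (z δ) (δ * R) ⊆ Ω)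
    (hzm : ∀ δ ∈ Ioo (0 : ℝ) 1, Reach Ω (z δ) m (1 - δ)) (hr₀ : 0 < r₀) {A B : E →L[ℂ] ℂ}
    (hA : ∀ x ∈ Ω, 0 < (A (ξ - x)).re) (hB : ∀ x ∈ Ω, 0 < (B (η - x)).re)
    (hAB : ∀ x ∈ Ω, r₀ ≤ ‖A (ξ - x)‖ ∨ r₀ ≤ ‖B (η - x)‖) {q : ℕ → E} (hq : ∀ n, q n ∈ Ω)
    (hqη : Tendsto q atTop (𝓝 η)) (hfq : Tendsto (fun n => f (q n)) atTop (𝓝 ζ)) {c : ℂ}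
    (hc : η + c • (ζ - η) ∈ Ω) : False := by
  obtain ⟨C, hC, ρ, hρ, δ₀, hδ₀, hzp⟩ := exists_reach_of_reach hΩo hΩc hm hzm hc
  set p := η + c • (ζ - η) with hp
  set N := 2 * ‖A‖ * R / r₀ + 1 with hN
  have hN0 : 0 < N := by positivity
  have hpn : Tendsto (fun n => q n + c • (f (q n) - q n)) atTop (𝓝 p) :=
    hqη.add ((hfq.sub hqη).const_smul c)
  have hBn : Tendsto (fun n => ‖B (η - q n)‖) atTop (𝓝 0) := by
    have h1 : Tendsto (fun n => ‖B (η - q n)‖) atTop (𝓝 ‖B (η - η)‖) :=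
      ((B.continuous.tendsto _).comp (hqη.const_sub η)).norm
    simpa using h1
  obtain ⟨n, hn1, hn2, hn3⟩ := ((hpn.eventually (ball_mem_nhds p (half_pos hρ))).and <|
    (hBn.eventually (gt_mem_nhds hr₀)).and
    (hBn.eventually (gt_mem_nhds (show 0 < r₀ * C / (4 * N) by positivity)))).exists
  obtain ⟨c', hc', ρ', hρ', δ₁, hδ₁, hzq⟩ := exists_reach_of_reach hΩo hΩc hm hzm (hq n)
  set C₀ := 10 + 68 * M * R ^ 3 + 68 * M ^ 2 * R ^ 2 with hC₀
  have hC₀0 : 0 < C₀ := by positivity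
  set ε := ρ * c' ^ 2 / (64 * (‖c‖ + 1) * C₀) with hε
  have hε0 : 0 < ε := by positivity
  obtain ⟨σ, hσ0, hσ⟩ := Metric.mem_nhdsWithin_iff.1 (hlim.eventually (gt_mem_nhds hε0))
  have hσ' : ∀ w ∈ Ω, ‖w - ξ‖ < σ → ‖f w - w‖ ≤ ε * ‖w - ξ‖ ^ 4 := by
    intro w hw hwσ
    have h1 : ‖f w - w‖ / ‖w - ξ‖ ^ 4 < ε := hσ ⟨by rwa [mem_ball, dist_eq_norm], hw⟩
    have h2 : 0 < ‖w - ξ‖ := norm_pos_iff.2 (sub_ne_zero.2 fun h => hξ (h ▸ hw))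
    rw [div_lt_iff₀ (by positivity)] at h1
    exact h1.le
  have hIoo : ∀ b : ℝ, 0 < b → ∀ᶠ δ in 𝓝[>] (0 : ℝ), δ ∈ Ioo 0 b := fun b hb =>
    Ioo_mem_nhdsGT hb
  have hlow : ∀ᶠ δ in 𝓝[>] 0, ∀ s, 0 < s → s < 1 → Reach Ω (z δ) (q n) s → 1 - s < C * δ := by
    filter_upwards [hIoo 1 one_pos, hIoo (1 / (2 * N)) (by positivity)] with δ hδ hδN s hs hs1 h
    have hNδ : N * δ ≤ 1 / 2 := by
      have := hδN.2.le
      rw [le_div_iff₀ (by positivity)] at this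
      linarith
    have hAz : 2 * ‖A (ξ - z δ)‖ < r₀ * (N * δ) := by
      have h1 := A.le_opNorm (ξ - z δ)
      rw [norm_sub_rev, hzξ δ hδ] at h1
      have h2 : r₀ * (N * δ) = 2 * (‖A‖ * (δ * R)) + r₀ * δ := by
        rw [hN]; field_simp
      have := mul_pos hr₀ hδ.1
      linarith
    have h1 := h.one_sub_le hs hs1 hA hB hAB hδ.1 hN0 hNδ hAz hn2
    rw [lt_div_iff₀ (by positivity)] at hn3
    have h2 : 4 * ‖B (η - q n)‖ * (N * δ) < r₀ * (C * δ) := by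
      have := mul_lt_mul_of_pos_right hn3 hδ.1
      linarith
    exact lt_of_mul_lt_mul_left (h1.trans_lt h2) hr₀.le
  obtain ⟨L, hL0, hL1, hL2⟩ := exists_separating_almost_orthogonal hΩo hΩc hf hfm hM0 hM hσ0 hσ'
    hε0 hR hc' (half_pos hρ) (z := z) (p := q n + c • (f (q n) - q n)) (q := q n) (C := C) (hq n)
    (by
      filter_upwards [hIoo 1 one_pos] with δ hδ
      exact ⟨hzξ δ hδ, hzball δ hδ⟩)
    (by
      filter_upwards [hIoo δ₁ hδ₁] with δ hδ
      exact hzq δ hδ _ (mem_ball_self hρ'))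
    (by
      filter_upwards [hIoo δ₀ hδ₀] with δ hδ x hx
      refine hzp δ hδ x ?_
      rw [mem_ball] at hx ⊢
      linarith [dist_triangle x (q n + c • (f (q n) - q n)) p])
    hlow
  have hLpos : 0 < ‖L‖ := norm_pos_iff.2 hL0
  have h1 : ρ / 2 * ‖L‖ ≤ ‖c‖ * ‖L (f (q n) - q n)‖ := by
    refine hL1.trans ?_
    rw [← norm_mul, map_add, map_smul, smul_eq_mul, Complex.add_re, sub_add_cancel_left]
    exact (neg_le_abs _).trans (Complex.abs_re_le_norm _)
  have h2 : ρ / 2 * c' ^ 2 * ‖L‖ ≤ 16 * ‖c‖ * ε * C₀ * ‖L‖ := by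
    calc ρ / 2 * c' ^ 2 * ‖L‖ = ρ / 2 * ‖L‖ * c' ^ 2 := by ring
      _ ≤ ‖c‖ * ‖L (f (q n) - q n)‖ * c' ^ 2 := by gcongr
      _ = ‖c‖ * (‖L (f (q n) - q n)‖ * c' ^ 2) := by ring
      _ ≤ ‖c‖ * (16 * (‖L‖ * (ε * C₀))) := by gcongr
      _ = _ := by ring
  have h3 := le_of_mul_le_mul_right h2 hLpos
  have h4 : 64 * (‖c‖ + 1) * C₀ * ε = ρ * c' ^ 2 := by rw [hε]; field_simp
  have h5 : 0 < ε * C₀ := mul_pos hε0 hC₀0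
  have h6 : 0 ≤ ‖c‖ * (ε * C₀) := by positivity
  nlinarith

end Reach

section Boundary

variable {E : Type*} [NormedAddCommGroup E]

/-- An open set with `C²` boundary has an interior tangent ball at each boundary point. -/
theorem exists_ball_subset_of_contDiffOn [InnerProductSpace ℂ E] [CompleteSpace E] {U : Set E}
    {r : E → ℝ} (hU : IsOpen U) (hr : ContDiffOn ℝ 2 r U) {ξ : E} (hξ : ξ ∈ U) (hrξ : r ξ ≤ 0)
    (hD : fderiv ℝ r ξ ≠ 0) :
    ∃ (m : E) (R : ℝ), 0 < R ∧ ‖ξ - m‖ = R ∧ ball m R ⊆ {z | z ∈ U ∧ r z < 0} := by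
  set D := fderiv ℝ r ξ with hDdef
  have hrat : ContDiffAt ℝ 2 r ξ := hr.contDiffAt (hU.mem_nhds hξ)
  have hf1 : ContDiffAt ℝ 1 (fderiv ℝ r) ξ := hrat.fderiv_right (by norm_num)
  obtain ⟨K, t, ht, hK⟩ := hf1.exists_lipschitzOnWith
  obtain ⟨ρ, hρ, hball⟩ := Metric.mem_nhds_iff.1 (inter_mem ht (hU.mem_nhds hξ))
  have taylor : ∀ x : E, ‖x‖ < ρ → r (ξ + x) ≤ D x + K * ‖x‖ * ‖x‖ := by
    intro x hx
    have hsub : closedBall ξ ‖x‖ ⊆ ball ξ ρ := closedBall_subset_ball hx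
    have := (convex_closedBall ξ ‖x‖).norm_image_sub_le_of_norm_hasFDerivWithin_le'
      (f := r) (f' := fderiv ℝ r) (φ := D) (C := K * ‖x‖) (𝕜 := ℝ) (x := ξ) (y := ξ + x)
      (fun y hy => (((hr.differentiableOn (by norm_num)).differentiableAt
        (hU.mem_nhds (hball (hsub hy)).2)).hasFDerivAt).hasFDerivWithinAt)
      (fun y hy => by
        have h1 := hK.norm_sub_le (hball (hsub hy)).1 (mem_of_mem_nhds ht)
        rw [mem_closedBall, dist_eq_norm] at hy
        exact h1.trans (by gcongr))
      (mem_closedBall_self (norm_nonneg x)) (by simp)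
    rw [add_sub_cancel_left, Real.norm_eq_abs] at this
    have := (abs_le.1 this).2
    linarith
  set ℓ : StrongDual ℂ E := StrongDual.extendRCLike (𝕜 := ℂ) D
  have hℓ : ∀ x, (ℓ x).re = D x := 
    StrongDual.re_extendRCLike_apply (𝕜 := ℂ) D
  set n := (InnerProductSpace.toDual ℂ E).symm ℓ
  have hn : ∀ x, (inner ℂ n x : ℂ).re = D x := fun x => by
    rw [InnerProductSpace.toDual_symm_apply, hℓ]
  have hn0 : 0 < ‖n‖ := by
    rw [norm_pos_iff]
    rintro h0
    refine hD (ContinuousLinearMap.ext fun x => ?_)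
    rw [← hn, h0]
    simp
  set R := min (ρ / 4) (‖n‖ / (4 * (K + 1))) with hR
  have hK0 : (0 : ℝ) ≤ K := K.coe_nonneg
  have hR0 : 0 < R := by positivity
  refine ⟨ξ - (R / ‖n‖ : ℝ) • n, R, hR0, ?_, ?_⟩
  · rw [sub_sub_cancel, norm_smul, Real.norm_of_nonneg (by positivity), div_mul_cancel₀ _ hn0.ne']
  intro y hy
  obtain ⟨x, rfl⟩ : ∃ x, y = ξ + x := ⟨y - ξ, by abel⟩
  rw [mem_ball, dist_eq_norm] at hy
  have e1 : ξ + x - (ξ - (R / ‖n‖ : ℝ) • n) = x + (R / ‖n‖ : ℝ) • n := by abel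
  rw [e1] at hy
  have hRn : ‖(R / ‖n‖ : ℝ) • n‖ = R := by
    rw [norm_smul, Real.norm_of_nonneg (by positivity), div_mul_cancel₀ _ hn0.ne']
  have hxρ : ‖x‖ < ρ := by
    have h1 := norm_le_add_norm_add x ((R / ‖n‖ : ℝ) • n)
    have h2 : R ≤ ρ / 4 := min_le_left _ _
    rw [hRn] at h1
    linarith
  have hsq : ‖x + (R / ‖n‖ : ℝ) • n‖ ^ 2 = ‖x‖ ^ 2 + 2 * (R / ‖n‖ * D x) + R ^ 2 := by
    rw [norm_add_sq (𝕜 := ℂ), hRn, ← hn, ← inner_re_symm]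
    congr 3
    rw [← Complex.coe_smul, inner_smul_left]
    simp
  have hlt : ‖x‖ ^ 2 + 2 * (R / ‖n‖ * D x) < 0 := by
    have := pow_lt_pow_left₀ hy (norm_nonneg _) two_ne_zero
    linarith
  have hDx : D x ≤ -(‖n‖ / (2 * R)) * ‖x‖ ^ 2 := by
    have h1 : ‖n‖ / (2 * R) * (2 * (R / ‖n‖ * D x)) = D x := by field_simp
    have h2 : 0 < ‖n‖ / (2 * R) := by positivity
    nlinarith
  have hx0 : 0 < ‖x‖ := by
    rcases (norm_nonneg x).eq_or_lt with h | h
    · rw [eq_comm, norm_eq_zero] at h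
      simp [h] at hlt
    · exact h
  have hKR : K + 1 ≤ ‖n‖ / (2 * R) := by
    have h2 : R ≤ ‖n‖ / (4 * (K + 1)) := min_le_right _ _
    rw [le_div_iff₀ (by positivity)] at h2 ⊢
    nlinarith
  refine ⟨(hball (by simpa using hxρ)).2, ?_⟩
  have h1 := taylor x hxρ
  nlinarith [pow_pos hx0 2]

theorem eq_zero_of_mem_frontier {Ω U : Set E} {r : E → ℝ} (hΩo : IsOpen Ω) (hUcl : closure Ω ⊆ U)
    (hr : ContinuousOn r U) (hΩdef : Ω = {z | z ∈ U ∧ r z < 0}) {ξ : E} (hξ : ξ ∈ frontier Ω) :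
    r ξ = 0 := by
  have hcl := frontier_subset_closure hξ
  refine le_antisymm ?_ ?_
  · refine ContinuousWithinAt.closure_le hcl
      ((hr ξ (hUcl hcl)).mono (subset_closure.trans hUcl)) continuousWithinAt_const fun y hy => ?_
    rw [hΩdef] at hy
    exact hy.2.le
  · by_contra! h
    rw [hΩo.frontier_eq] at hξ
    refine hξ.2 ?_
    rw [hΩdef]
    exact ⟨hUcl hcl, h⟩

variable [NormedSpace ℂ E]

theorem fderiv_sub_neg_of_mem_frontier {Ω U : Set E} {r : E → ℝ} (hΩo : IsOpen Ω)
    (hΩc : Convex ℝ Ω) (hUo : IsOpen U) (hUcl : closure Ω ⊆ U) (hr : DifferentiableOn ℝ r U)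
    (hΩdef : Ω = {z | z ∈ U ∧ r z < 0}) {ξ : E} (hξ : ξ ∈ frontier Ω) (hD : fderiv ℝ r ξ ≠ 0)
    {x : E} (hx : x ∈ Ω) : fderiv ℝ r ξ (x - ξ) < 0 := by
  have hcl := frontier_subset_closure hξ
  have h0 := eq_zero_of_mem_frontier hΩo hUcl hr.continuousOn hΩdef hξ
  have hle : ∀ y ∈ Ω, fderiv ℝ r ξ (y - ξ) ≤ 0 := by
    intro y hy
    have hmax : IsLocalMaxOn r (closure Ω) ξ := by
      filter_upwards [self_mem_nhdsWithin] with w hw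
      rw [h0]
      by_cases hwΩ : w ∈ Ω
      · rw [hΩdef] at hwΩ
        exact hwΩ.2.le
      · exact (eq_zero_of_mem_frontier hΩo hUcl hr.continuousOn hΩdef
          (by rw [hΩo.frontier_eq]; exact ⟨hw, hwΩ⟩)).le
    refine hmax.hasFDerivWithinAt_nonpos
      (hr.differentiableAt (hUo.mem_nhds (hUcl hcl))).hasFDerivAt.hasFDerivWithinAt ?_
    exact sub_mem_posTangentConeAt_of_segment_subset
      (hΩc.closure.segment_subset hcl (subset_closure hy))
  obtain ⟨u, hu⟩ : ∃ u, 0 < fderiv ℝ r ξ u := by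
    by_contra! h
    refine hD (ContinuousLinearMap.ext fun u => le_antisymm (h u) ?_)
    have := h (-u)
    rw [map_neg] at this
    simpa using this
  have hcont : Tendsto (fun t : ℝ => x + t • u) (𝓝[>] 0) (𝓝 x) := by
    have : Tendsto (fun t : ℝ => x + t • u) (𝓝 0) (𝓝 (x + (0 : ℝ) • u)) :=
      (by fun_prop : Continuous fun t : ℝ => x + t • u).tendsto 0
    rw [zero_smul, add_zero] at this
    exact this.mono_left nhdsWithin_le_nhds
  obtain ⟨t, ht, ht0⟩ :=
    ((hcont.eventually (hΩo.mem_nhds hx)).and (eventually_mem_nhdsWithin)).exists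
  have h1 := hle _ ht
  rw [show x + t • u - ξ = (x - ξ) + t • u by abel, map_add, map_smul, smul_eq_mul] at h1
  have := mul_pos (show 0 < t from ht0) hu
  linarith

theorem exists_add_smul_mem_of_fderiv_neg {Ω U : Set E} {r : E → ℝ} (hUo : IsOpen U)
    (hr : DifferentiableOn ℝ r U) (hΩdef : Ω = {z | z ∈ U ∧ r z < 0}) {η : E} (hη : η ∈ U)
    (h0 : r η = 0) {w : E} (hw : fderiv ℝ r η w < 0) : ∃ t : ℝ, 0 < t ∧ η + t • w ∈ Ω := by
  by_contra! h
  have hmin : IsLocalMinOn r (segment ℝ η (η + w)) η := by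
    filter_upwards [self_mem_nhdsWithin, mem_nhdsWithin_of_mem_nhds (hUo.mem_nhds hη)] with y hy hyU
    rw [segment_eq_image'] at hy
    obtain ⟨t, ht, rfl⟩ := hy
    rw [add_sub_cancel_left] at hyU ⊢
    rcases ht.1.eq_or_lt with rfl | ht0
    · simp
    · rw [h0]
      by_contra! hneg
      exact h t ht0 (by rw [hΩdef]; exact ⟨hyU, hneg⟩)
  have := hmin.hasFDerivWithinAt_nonneg
    (hr.differentiableAt (hUo.mem_nhds hη)).hasFDerivAt.hasFDerivWithinAt
    (mem_posTangentConeAt_of_segment_subset Subset.rfl)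
  linarith

/-- Being in the closed complex face of a boundary point is a symmetric relation. -/
theorem mem_cxTangent_symm {Ω U : Set E} {r : E → ℝ} (hΩo : IsOpen Ω)
    (hΩc : Convex ℝ Ω) (hUo : IsOpen U) (hUcl : closure Ω ⊆ U) (hr : DifferentiableOn ℝ r U)
    (hΩdef : Ω = {z | z ∈ U ∧ r z < 0}) {ξ η : E} (hξ : ξ ∈ frontier Ω) (hη : η ∈ frontier Ω)
    (hDξ : fderiv ℝ r ξ ≠ 0) (hDη : fderiv ℝ r η ≠ 0) (h : η ∈ cxTangent r ξ) :
    ξ ∈ cxTangent r η := by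
  have hneg : ∀ w, fderiv ℝ r η w < 0 → fderiv ℝ r ξ w < 0 := by
    intro w hw
    obtain ⟨t, ht, htΩ⟩ := exists_add_smul_mem_of_fderiv_neg hUo hr hΩdef
      (hUcl (frontier_subset_closure hη))
      (eq_zero_of_mem_frontier hΩo hUcl hr.continuousOn hΩdef hη) hw
    have h1 := fderiv_sub_neg_of_mem_frontier hΩo hΩc hUo hUcl hr hΩdef hξ hDξ htΩ
    rw [show η + t • w - ξ = (η - ξ) + t • w by abel, map_add, h.1, zero_add, map_smul,
      smul_eq_mul] at h1
    exact (pos_iff_neg_of_mul_neg h1).1 ht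
  obtain ⟨w, hw⟩ : ∃ w, fderiv ℝ r η w = -1 := by
    obtain ⟨u, hu⟩ : ∃ u, fderiv ℝ r η u ≠ 0 := by
      by_contra! h
      exact hDη (ContinuousLinearMap.ext h)
    exact ⟨(-(fderiv ℝ r η u)⁻¹) • u, by rw [map_smul, smul_eq_mul, neg_mul, inv_mul_cancel₀ hu]⟩
  have hwξ : fderiv ℝ r ξ w < 0 := hneg w (by rw [hw]; norm_num)
  have hker : ∀ x, fderiv ℝ r η x = 0 → fderiv ℝ r ξ x = 0 := by
    intro x hx
    by_contra hne
    have := hneg ((-(fderiv ℝ r ξ w) / fderiv ℝ r ξ x) • x + w) (by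
      rw [map_add, map_smul, hx, hw]; norm_num)
    rw [map_add, map_smul, smul_eq_mul, div_mul_cancel₀ _ hne] at this
    simp at this
  have hker' : ∀ x, fderiv ℝ r ξ x = 0 → fderiv ℝ r η x = 0 := by
    intro x hx
    have := hker (x + fderiv ℝ r η x • w) (by
      rw [map_add, map_smul, hw, smul_eq_mul]; ring)
    rw [map_add, map_smul, hx, zero_add, smul_eq_mul] at this
    exact (mul_eq_zero.1 this).resolve_right hwξ.ne
  refine ⟨hker' _ ?_, hker' _ ?_⟩
  · rw [← neg_sub, map_neg, h.1, neg_zero]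
  · rw [← neg_sub, smul_neg, map_neg, h.2, neg_zero]

theorem extendRCLike_eq_zero_iff_mem_cxTangent {r : E → ℝ} {ξ x : E} :
    StrongDual.extendRCLike (𝕜 := ℂ) (fderiv ℝ r ξ) (ξ - x) = 0 ↔ x ∈ cxTangent r ξ := by
  set A := StrongDual.extendRCLike (𝕜 := ℂ) (fderiv ℝ r ξ)
  have hA : ∀ y, (A y).re = fderiv ℝ r ξ y :=
    StrongDual.re_extendRCLike_apply (𝕜 := ℂ) (fderiv ℝ r ξ)
  rw [← neg_sub x ξ, map_neg, neg_eq_zero]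
  have hI : fderiv ℝ r ξ (Complex.I • (x - ξ)) = -(A (x - ξ)).im := by
    rw [← hA, map_smul]
    simp
  change _ ↔ _ ∧ _
  rw [hI, ← hA, neg_eq_zero, Complex.ext_iff]
  rfl

end Boundary

theorem tendsto_of_displacement_isLittleO {E : Type*} [NormedAddCommGroup E]
    {Ω : Set E} (hΩo : IsOpen Ω) {f : E → E} {ξ : E} (hξ : ξ ∈ frontier Ω)
    (hlim : Tendsto (fun z => ‖f z - z‖ / ‖z - ξ‖ ^ 4) (𝓝[Ω] ξ) (𝓝 0)) :
    Tendsto f (𝓝[Ω] ξ) (𝓝 ξ) := by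
  rw [hΩo.frontier_eq] at hξ
  have h4 : Tendsto (fun z => ‖z - ξ‖ ^ 4) (𝓝[Ω] ξ) (𝓝 0) := by
    have : Tendsto (fun z => ‖z - ξ‖ ^ 4) (𝓝 ξ) (𝓝 (‖ξ - ξ‖ ^ 4)) :=
      (by fun_prop : Continuous fun z => ‖z - ξ‖ ^ 4).tendsto ξ
    rw [sub_self, norm_zero, zero_pow four_ne_zero] at this
    exact this.mono_left nhdsWithin_le_nhds
  have h0 : Tendsto (fun z => ‖f z - z‖) (𝓝[Ω] ξ) (𝓝 0) := by
    have := hlim.mul h4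
    rw [zero_mul] at this
    refine this.congr' ?_
    filter_upwards [self_mem_nhdsWithin] with z hz
    have : ‖z - ξ‖ ≠ 0 := norm_ne_zero_iff.2 (sub_ne_zero.2 fun h => hξ.2 (h ▸ hz))
    field_simp
  have := (tendsto_zero_iff_norm_tendsto_zero.2 h0).add
    (tendsto_id.mono_left nhdsWithin_le_nhds : Tendsto id (𝓝[Ω] ξ) (𝓝 ξ))
  simpa using this

theorem reach_of_ball_subset {E : Type*} [NormedAddCommGroup E] [NormedSpace ℂ E]
    {Ω : Set E} {m ξ : E} (hball : ball m ‖ξ - m‖ ⊆ Ω) (hξ : ξ ≠ m) {δ : ℝ}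
    (hδ : δ ∈ Ioo (0 : ℝ) 1) :
    Reach Ω (m + (1 - δ) • (ξ - m)) m (1 - δ) := by
  have hpos : 0 < ‖ξ - m‖ := norm_pos_iff.2 (sub_ne_zero.2 hξ)
  refine Reach.symm (Ω := Ω) ⟨fun ζ : ℂ => m + ζ • (ξ - m), ?_, ?_, ?_, ?_⟩ ?_
  · fun_prop
  · intro ζ hζ
    refine hball ?_
    rw [mem_ball_zero_iff] at hζ
    rw [mem_ball_iff_norm, add_sub_cancel_left, norm_smul]
    nlinarith
  · simp
  · simp [← Complex.coe_smul]
  · rw [abs_lt]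
    constructor <;> linarith [hδ.1, hδ.2]

/-- Two boundary points which do not share a closed complex face are separated by the pair of
their supporting complex functionals, uniformly on the domain. -/
theorem exists_pos_le_norm_or_le_norm {E : Type*} [NormedAddCommGroup E] [NormedSpace ℂ E]
    [ProperSpace E] {Ω : Set E} (hΩne : Ω.Nonempty) (hΩb : Bornology.IsBounded Ω)
    {A B : E →L[ℂ] ℂ} {ξ η : E}
    (h : ∀ x ∈ closure Ω, B (η - x) = 0 → A (ξ - x) ≠ 0) :
    ∃ r₀ > 0, ∀ x ∈ Ω, r₀ ≤ ‖A (ξ - x)‖ ∨ r₀ ≤ ‖B (η - x)‖ := by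
  have hcont : Continuous fun x => max ‖A (ξ - x)‖ ‖B (η - x)‖ := by fun_prop
  obtain ⟨x₀, hx₀, hmin⟩ := hΩb.isCompact_closure.exists_isMinOn hΩne.closure hcont.continuousOn
  refine ⟨max ‖A (ξ - x₀)‖ ‖B (η - x₀)‖, ?_, fun x hx => le_max_iff.1 (hmin (subset_closure hx))⟩
  by_contra! hle
  rw [max_le_iff, norm_le_zero_iff, norm_le_zero_iff] at hle
  exact h x₀ hx₀ hle.2 hle.1

theorem tendsto_of_displacement {E : Type*} [NormedAddCommGroup E] [InnerProductSpace ℂ E]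
    [ProperSpace E] {Ω U : Set E} {r : E → ℝ}
    (hΩo : IsOpen Ω) (hΩne : Ω.Nonempty) (hΩb : Bornology.IsBounded Ω) (hΩc : Convex ℝ Ω)
    (hUo : IsOpen U) (hUcl : closure Ω ⊆ U) (hr : ContDiffOn ℝ 2 r U)
    (hΩdef : Ω = {z | z ∈ U ∧ r z < 0}) (hgrad : ∀ z ∈ frontier Ω, fderiv ℝ r z ≠ 0)
    {f : E → E} (hf : DifferentiableOn ℂ f Ω) (hfm : MapsTo f Ω Ω)
    {ξ₀ : E} (hξ : ξ₀ ∈ frontier Ω)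
    (hlim : Tendsto (fun z => ‖f z - z‖ / ‖z - ξ₀‖ ^ 4) (𝓝[Ω] ξ₀) (𝓝 0))
    {η : E} (hη : η ∈ frontier Ω) (hface : frontier Ω ∩ cxTangent r η = {η})
    {q : ℕ → E} (hq : ∀ n, q n ∈ Ω) (hqlim : Tendsto q atTop (𝓝 η)) :
    Tendsto (fun n => f (q n)) atTop (𝓝 η) := by
  rcases eq_or_ne ξ₀ η with rfl | hne
  · exact (tendsto_of_displacement_isLittleO hΩo hξ hlim).comp
      (tendsto_nhdsWithin_iff.2 ⟨hqlim, Eventually.of_forall hq⟩)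
  have hrd : DifferentiableOn ℝ r U := hr.differentiableOn (by norm_num)
  have hdiff : ∀ {x}, x ∈ closure Ω → x ∉ Ω → x ∈ frontier Ω := fun hx hx' => by
    rw [hΩo.frontier_eq]; exact ⟨hx, hx'⟩
  have hξcl := frontier_subset_closure hξ
  have hξΩ : ξ₀ ∉ Ω := by
    rw [hΩo.frontier_eq] at hξ; exact hξ.2
  have hpos : ∀ {ξ}, ξ ∈ frontier Ω → ∀ x ∈ Ω,
      0 < (StrongDual.extendRCLike (𝕜 := ℂ) (fderiv ℝ r ξ) (ξ - x)).re := by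
    intro ξ hξ x hx
    have h1 : (StrongDual.extendRCLike (𝕜 := ℂ) (fderiv ℝ r ξ) (ξ - x)).re
        = fderiv ℝ r ξ (ξ - x) := StrongDual.re_extendRCLike_apply (𝕜 := ℂ) (fderiv ℝ r ξ) _
    rw [h1, ← neg_sub, map_neg, neg_pos]
    exact fderiv_sub_neg_of_mem_frontier hΩo hΩc hUo hUcl hrd hΩdef hξ (hgrad ξ hξ) hx
  have hBzero : ∀ x ∈ closure Ω,
      StrongDual.extendRCLike (𝕜 := ℂ) (fderiv ℝ r η) (η - x) = 0 → x = η := by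
    intro x hx h0
    have hxf : x ∈ frontier Ω := hdiff hx fun hxΩ => by
      have := hpos hη x hxΩ
      rw [h0] at this
      exact lt_irrefl _ this
    have : x ∈ frontier Ω ∩ cxTangent r η := ⟨hxf, extendRCLike_eq_zero_iff_mem_cxTangent.1 h0⟩
    rwa [hface] at this
  obtain ⟨r₀, hr₀, hAB⟩ := exists_pos_le_norm_or_le_norm hΩne hΩb
    (A := StrongDual.extendRCLike (𝕜 := ℂ) (fderiv ℝ r ξ₀))
    (B := StrongDual.extendRCLike (𝕜 := ℂ) (fderiv ℝ r η)) (ξ := ξ₀) (η := η) (by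
      intro x hx hB hA
      obtain rfl := hBzero x hx hB
      have : ξ₀ ∈ frontier Ω ∩ cxTangent r x :=
        ⟨hξ, mem_cxTangent_symm hΩo hΩc hUo hUcl hrd hΩdef hξ hη (hgrad _ hξ) (hgrad _ hη)
          (extendRCLike_eq_zero_iff_mem_cxTangent.1 hA)⟩
      rw [hface] at this
      exact hne this)
  obtain ⟨m, R, hR, hmR, hball⟩ := exists_ball_subset_of_contDiffOn hUo hr (hUcl hξcl)
    (eq_zero_of_mem_frontier hΩo hUcl hrd.continuousOn hΩdef hξ).le (hgrad _ hξ)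
  rw [← hΩdef] at hball
  have hzξ : ∀ δ ∈ Ioo (0 : ℝ) 1, ‖m + (1 - δ) • (ξ₀ - m) - ξ₀‖ = δ * R := by
    intro δ hδ
    rw [show m + (1 - δ) • (ξ₀ - m) - ξ₀ = (-δ) • (ξ₀ - m) by module, norm_smul, hmR, norm_neg,
      Real.norm_of_nonneg hδ.1.le]
  have hzball : ∀ δ ∈ Ioo (0 : ℝ) 1, ball (m + (1 - δ) • (ξ₀ - m)) (δ * R) ⊆ Ω := by
    intro δ hδ
    refine (ball_subset_ball' ?_).trans hball
    rw [dist_eq_norm, add_sub_cancel_left, norm_smul, hmR,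
      Real.norm_of_nonneg (by linarith [hδ.2])]
    linarith
  have hξm : ξ₀ ≠ m := by
    rintro rfl
    rw [sub_self, norm_zero] at hmR
    exact hR.ne hmR
  refine tendsto_of_subseq_tendsto fun ns hns => ?_
  obtain ⟨ζ, hζ, φ, hφ, hφlim⟩ := hΩb.isCompact_closure.tendsto_subseq
    (x := fun n => f (q (ns n))) fun n => subset_closure (hfm (hq _))
  refine ⟨φ, ?_⟩
  suffices ζ = η by rwa [this] at hφlim
  by_contra hζη
  set B := StrongDual.extendRCLike (𝕜 := ℂ) (fderiv ℝ r η) with hBdef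
  have hBζ : B (ζ - η) ≠ 0 := fun h => hζη (hBzero ζ hζ (by rw [← neg_sub, map_neg, h, neg_zero]))
  obtain ⟨t, -, ht⟩ := exists_add_smul_mem_of_fderiv_neg hUo hrd hΩdef
    (hUcl (frontier_subset_closure hη))
    (eq_zero_of_mem_frontier hΩo hUcl hrd.continuousOn hΩdef hη)
    (w := (-(B (ζ - η))⁻¹) • (ζ - η)) (by
      have h1 : ∀ y, (B y).re = fderiv ℝ r η y :=
        StrongDual.re_extendRCLike_apply (𝕜 := ℂ) (fderiv ℝ r η)
      rw [← h1, map_smul, smul_eq_mul, neg_mul, inv_mul_cancel₀ hBζ]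
      norm_num)
  rw [← Complex.coe_smul, smul_smul] at ht
  refine false_of_displacement (M := diam Ω + 1) hΩo hΩc hf hfm (by positivity)
    (fun x hx y hy => ?_) hξΩ hlim hR (hball (mem_ball_self hR)) hzξ hzball
    (fun δ hδ => reach_of_ball_subset (by rwa [hmR]) hξm hδ) hr₀ (hpos hξ) (hpos hη) hAB
    (fun n => hq (ns (φ n))) (hqlim.comp (hns.comp hφ.tendsto_atTop)) hφlim ht
  rw [← dist_eq_norm]
  linarith [dist_le_diam_of_mem hΩb hx hy]

/-- Suppose `Ω ⊂ ℂ^d` is a bounded convex domain with `C²` boundary,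
`f : Ω → Ω` is holomorphic with `f(z) = z + o(‖z - ξ₀‖⁴)` at `ξ₀ ∈ ∂Ω`. If `η ∈ ∂Ω` has
`∂Ω ∩ H_η ∂Ω = {η}` and `q_n ∈ Ω` with `q_n → η`, then `f(q_n) → η`. -/
theorem statement11 {d : ℕ} (Ω U : Set (EuclideanSpace ℂ (Fin d))) (r : EuclideanSpace ℂ (Fin d) → ℝ)
    (hΩo : IsOpen Ω) (hΩne : Ω.Nonempty) (hΩb : Bornology.IsBounded Ω) (hΩc : Convex ℝ Ω)
    (hUo : IsOpen U) (hUcl : closure Ω ⊆ U) (hr : ContDiffOn ℝ 2 r U)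
    (hΩdef : Ω = {z | z ∈ U ∧ r z < 0}) (hgrad : ∀ z ∈ frontier Ω, fderiv ℝ r z ≠ 0)
    (f : EuclideanSpace ℂ (Fin d) → EuclideanSpace ℂ (Fin d))
    (hf : DifferentiableOn ℂ f Ω) (hfm : MapsTo f Ω Ω)
    (ξ₀ : EuclideanSpace ℂ (Fin d)) (hξ : ξ₀ ∈ frontier Ω)
    (hlim : Tendsto (fun z => ‖f z - z‖ / ‖z - ξ₀‖ ^ 4) (𝓝[Ω] ξ₀) (𝓝 0))
    (η : EuclideanSpace ℂ (Fin d)) (hη : η ∈ frontier Ω)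
    (hface : frontier Ω ∩ cxTangent r η = {η})
    (q : ℕ → EuclideanSpace ℂ (Fin d)) (hq : ∀ n, q n ∈ Ω) (hqlim : Tendsto q atTop (𝓝 η)) :
    Tendsto (fun n => f (q n)) atTop (𝓝 η) := by
  exact tendsto_of_displacement hΩo hΩne hΩb hΩc hUo hUcl hr hΩdef hgrad hf hfm hξ hlim hη hface hq
    hqlim

end
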